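/- For every partition λ with at most n parts, the interpolation Macdonald polynomial satisfies P*_λ = Σ_{μ ∈ S_n(λ)} f*_μ. -/

import Mathlib

open MvPolynomial

noncomputable section
open scoped Classical

/-- The field `K = ℚ(q,t)`. -/
abbrev K : Type := FractionRing (MvPolynomial (Fin 2) ℚ)

/-- The indeterminate `q` as an element of `K`. -/
def qq : K := algebraMap (MvPolynomial (Fin 2) ℚ) K (X 0)

/-- The indeterminate `t` as an element of `K`. -/
def tt : K := algebraMap (MvPolynomial (Fin 2) ℚ) K (X 1)

/-- The size `|ν|` of a composition. -/
def csize {n : ℕ} (ν : Fin n → ℕ) : ℕ := ∑ i, ν i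

/-- `k_i(ν) = #{j < i : ν_j > ν_i} + #{j > i : ν_j ≥ ν_i}`. -/
def kstat {n : ℕ} (ν : Fin n → ℕ) (i : Fin n) : ℕ :=
  Set.ncard {j : Fin n | j < i ∧ ν i < ν j} + Set.ncard {j : Fin n | i < j ∧ ν i ≤ ν j}

/-- The evaluation point `ν̃ = (q^{ν_i} t^{-k_i(ν)})_i`. -/
def evalPt {n : ℕ} (ν : Fin n → ℕ) : Fin n → K :=
  fun i => qq ^ ν i * tt ^ (-(kstat ν i : ℤ))

/-- Weakly decreasing composition. -/
def IsPartition {n : ℕ} (l : Fin n → ℕ) : Prop := ∀ i j : Fin n, i ≤ j → l j ≤ l i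

/-- The action `σ·μ := μ ∘ σ⁻¹`. -/
def permAct {n : ℕ} (σ : Equiv.Perm (Fin n)) (μ : Fin n → ℕ) : Fin n → ℕ := μ ∘ ⇑σ.symm

/-- `S_n(λ)`: the rearrangements of `λ`. -/
def Sn {n : ℕ} (l : Fin n → ℕ) : Set (Fin n → ℕ) :=
  {μ | ∃ σ : Equiv.Perm (Fin n), permAct σ l = μ}

/-- The rearrangements of `λ` as a `Finset`. -/
def SnFinset {n : ℕ} (l : Fin n → ℕ) : Finset (Fin n → ℕ) :=
  Finset.image (fun σ : Equiv.Perm (Fin n) => permAct σ l) Finset.univ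

/-- The exponent `Finsupp` of the monomial `x^μ`. -/
def expOf {n : ℕ} (μ : Fin n → ℕ) : Fin n →₀ ℕ := Finsupp.equivFunOnFinite.symm μ

/-- Characterization of the interpolation nonsymmetric Macdonald polynomial `E*_μ`. -/
def IsEstar {n : ℕ} (μ : Fin n → ℕ) (f : MvPolynomial (Fin n) K) : Prop :=
  f.totalDegree ≤ csize μ ∧ coeff (expOf μ) f = 1 ∧
    ∀ ν : Fin n → ℕ, csize ν ≤ csize μ → ν ≠ μ → eval (evalPt ν) f = 0

/-- The interpolation nonsymmetric Macdonald polynomial `E*_μ` (unique by Knop–Sahi). -/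
def Estar {n : ℕ} (μ : Fin n → ℕ) : MvPolynomial (Fin n) K :=
  if h : ∃ f, IsEstar μ f then h.choose else 0

/-- Characterization of the interpolation (symmetric) Macdonald polynomial `P*_λ`. -/
def IsPstar {n : ℕ} (l : Fin n → ℕ) (f : MvPolynomial (Fin n) K) : Prop :=
  f.IsSymmetric ∧ f.totalDegree ≤ csize l ∧ coeff (expOf l) f = 1 ∧
    ∀ ν : Fin n → ℕ, IsPartition ν → csize ν ≤ csize l → ν ≠ l → eval (evalPt ν) f = 0

/-- The interpolation Macdonald polynomial `P*_λ`. -/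
def Pstar {n : ℕ} (l : Fin n → ℕ) : MvPolynomial (Fin n) K :=
  if h : ∃ f, IsPstar l f then h.choose else 0

/-- The space `V*_λ`. -/
def Vstar {n : ℕ} (l : Fin n → ℕ) : Submodule K (MvPolynomial (Fin n) K) :=
  (restrictTotalDegree (Fin n) K (csize l)) ⊓
    ⨅ (ν : Fin n → ℕ) (_ : csize ν ≤ csize l ∧ ν ∉ Sn l),
      LinearMap.ker (aeval (R := K) (evalPt ν)).toLinearMap

/-- Exchange of the variables `x_i` and `x_j` in a polynomial. -/
def swapVars {n : ℕ} (i j : Fin n) (f : MvPolynomial (Fin n) K) : MvPolynomial (Fin n) K :=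
  rename (Equiv.swap i j) f

/-- Exact division of polynomials: the unique `g` with `a = b * g` when it exists. -/
def exactDiv {n : ℕ} (a b : MvPolynomial (Fin n) K) : MvPolynomial (Fin n) K :=
  if h : ∃ g, a = b * g then h.choose else 0

/-- The Hecke operator
`T f = t f − ((t x_i − x_j)/(x_i − x_j))·(f − s_i f)` (where `j = i+1`). -/
def hecke {n : ℕ} (i j : Fin n) (f : MvPolynomial (Fin n) K) : MvPolynomial (Fin n) K :=
  C tt * f - (C tt * X i - X j) * exactDiv (f - swapVars i j f) (X i - X j)

/-- The Coxeter length of a permutation (number of inversions). -/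
def permLength {n : ℕ} (σ : Equiv.Perm (Fin n)) : ℕ :=
  Set.ncard {p : Fin n × Fin n | p.1 < p.2 ∧ σ p.2 < σ p.1}

/-- The adjacent transposition `s_i = (i, i+1)` (0-indexed). -/
def adjSwap {n : ℕ} (i : {i : ℕ // i + 1 < n}) : Equiv.Perm (Fin n) :=
  Equiv.swap ⟨i.1, Nat.lt_of_succ_lt i.2⟩ ⟨i.1 + 1, i.2⟩

/-- The Hecke operator `T_i` for an adjacent transposition index. -/
def heckeAt {n : ℕ} (i : {i : ℕ // i + 1 < n}) :
    MvPolynomial (Fin n) K → MvPolynomial (Fin n) K :=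
  hecke ⟨i.1, Nat.lt_of_succ_lt i.2⟩ ⟨i.1 + 1, i.2⟩

/-- `T_{i_1} ⋯ T_{i_ℓ} f` for a word `w = [i_1, …, i_ℓ]`. -/
def Tword {n : ℕ} (w : List {i : ℕ // i + 1 < n}) (f : MvPolynomial (Fin n) K) :
    MvPolynomial (Fin n) K :=
  w.foldr heckeAt f

/-- `w` is a reduced word for `σ`. -/
def IsReducedWordOf {n : ℕ} (w : List {i : ℕ // i + 1 < n}) (σ : Equiv.Perm (Fin n)) : Prop :=
  (w.map adjSwap).prod = σ ∧ w.length = permLength σ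

/-- `T_σ`, computed from a reduced word of `σ` (independent of the choice, by the
Hecke algebra relations). -/
def Tsigma {n : ℕ} (σ : Equiv.Perm (Fin n)) :
    MvPolynomial (Fin n) K → MvPolynomial (Fin n) K :=
  if h : ∃ w, IsReducedWordOf w σ then Tword h.choose else id

/-- `σ_μ`: the (unique) shortest permutation with `σ·l = μ`. -/
def sigmaMin {n : ℕ} (l μ : Fin n → ℕ) : Equiv.Perm (Fin n) :=
  if h : ∃ σ, permAct σ l = μ ∧ ∀ τ, permAct τ l = μ → permLength σ ≤ permLength τ then
    h.choose else 1

/-- The weakly decreasing rearrangement of a composition. -/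
def sortDesc {n : ℕ} (μ : Fin n → ℕ) : Fin n → ℕ :=
  if h : ∃ l, IsPartition l ∧ μ ∈ Sn l then h.choose else μ

/-- The interpolation ASEP polynomial `f*_μ = T_{σ_μ} E*_λ`, where `λ` is the weakly
decreasing rearrangement of `μ`. -/
def fstar {n : ℕ} (μ : Fin n → ℕ) : MvPolynomial (Fin n) K :=
  Tsigma (sigmaMin (sortDesc μ) μ) (Estar (sortDesc μ))

/-- The composition with entries `i` and `j` exchanged. -/
def swapEntries {n : ℕ} (i j : Fin n) (μ : Fin n → ℕ) : Fin n → ℕ := μ ∘ ⇑(Equiv.swap i j)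

/-! ### Constants -/

lemma qq_ne_zero : qq ≠ 0 := by
  unfold qq
  rw [Ne, FaithfulSMul.algebraMap_eq_zero_iff]
  exact X_ne_zero 0

lemma tt_ne_zero : tt ≠ 0 := by
  unfold tt
  rw [Ne, FaithfulSMul.algebraMap_eq_zero_iff]
  exact X_ne_zero 1

lemma qt_inj_nat (a b c d : ℕ) (h : qq ^ a * tt ^ c = qq ^ b * tt ^ d) : a = b ∧ c = d := by
  unfold qq tt at h
  rw [← map_pow, ← map_pow, ← map_pow, ← map_pow, ← map_mul, ← map_mul] at h
  have h2 := FaithfulSMul.algebraMap_injective (MvPolynomial (Fin 2) ℚ) K h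
  have key : ∀ a c : ℕ, (X 0 : MvPolynomial (Fin 2) ℚ) ^ a * X 1 ^ c =
      monomial (Finsupp.single 0 a + Finsupp.single 1 c) 1 := by
    intro a c
    rw [X_pow_eq_monomial, X_pow_eq_monomial, monomial_mul, one_mul]
  rw [key, key] at h2
  have h3 := (monomial_left_injective (one_ne_zero : (1 : ℚ) ≠ 0)) h2
  have e0 := DFunLike.congr_fun h3 0
  have e1 := DFunLike.congr_fun h3 1
  simp at e0 e1
  exact ⟨e0, e1⟩

lemma qt_inj (a b : ℕ) (c d : ℤ) (h : qq ^ a * tt ^ c = qq ^ b * tt ^ d) : a = b := by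
  obtain ⟨c', hc⟩ : ∃ c' : ℕ, c + (c.natAbs + d.natAbs : ℕ) = c' :=
    ⟨(c + (c.natAbs + d.natAbs : ℕ)).toNat, by omega⟩
  obtain ⟨d', hd⟩ : ∃ d' : ℕ, d + (c.natAbs + d.natAbs : ℕ) = d' :=
    ⟨(d + (c.natAbs + d.natAbs : ℕ)).toNat, by omega⟩
  have h2 : qq ^ a * tt ^ c' = qq ^ b * tt ^ d' := by
    rw [← zpow_natCast tt c', ← zpow_natCast tt d', ← hc, ← hd, zpow_add₀ tt_ne_zero,
      zpow_add₀ tt_ne_zero, ← mul_assoc, ← mul_assoc, h]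
  exact (qt_inj_nat _ _ _ _ h2).1

lemma tt_ne_one : tt ≠ 1 := by
  intro h
  have := qt_inj_nat 0 0 1 0 (by simp [h])
  omega

lemma evalPt_ne_zero {n : ℕ} (ν : Fin n → ℕ) (i : Fin n) : evalPt ν i ≠ 0 := by
  unfold evalPt
  exact mul_ne_zero (pow_ne_zero _ qq_ne_zero) (zpow_ne_zero _ tt_ne_zero)

/-! ### The Hecke operator -/

section Hecke
variable {n : ℕ}

lemma X_sub_X_ne_zero {i j : Fin n} (hij : i ≠ j) : (X i - X j : MvPolynomial (Fin n) K) ≠ 0 := by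
  intro h
  exact hij (X_injective (sub_eq_zero.mp h))

lemma X_sub_dvd (i j : Fin n) (f : MvPolynomial (Fin n) K) :
    (X i - X j) ∣ f - swapVars i j f := by
  unfold swapVars
  induction f using MvPolynomial.induction_on with
  | C a => simp
  | add p q hp hq =>
    rw [map_add, add_sub_add_comm]
    exact dvd_add hp hq
  | mul_X p k hp =>
    rw [map_mul, rename_X]
    have e : p * X k - rename (Equiv.swap i j) p * X (Equiv.swap i j k) =
        (p - rename (Equiv.swap i j) p) * X k +
          rename (Equiv.swap i j) p * (X k - X (Equiv.swap i j k)) := by ring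
    rw [e]
    apply dvd_add (Dvd.dvd.mul_right hp _)
    apply Dvd.dvd.mul_left
    by_cases hi : k = i
    · subst hi; simp
    · by_cases hj : k = j
      · subst hj
        rw [Equiv.swap_apply_right]
        exact ⟨-1, by ring⟩
      · rw [Equiv.swap_apply_of_ne_of_ne hi hj]; simp

lemma exactDiv_spec (i j : Fin n) (f : MvPolynomial (Fin n) K) :
    (X i - X j) * exactDiv (f - swapVars i j f) (X i - X j) = f - swapVars i j f := by
  have h : ∃ g, f - swapVars i j f = (X i - X j) * g := X_sub_dvd i j f
  unfold exactDiv
  rw [dif_pos h]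
  exact h.choose_spec.symm

lemma hecke_spec (i j : Fin n) (f : MvPolynomial (Fin n) K) :
    (X i - X j) * hecke i j f =
      (1 - C tt) * (X j * f) + (C tt * (X i * swapVars i j f) - X j * swapVars i j f) := by
  have h := exactDiv_spec i j f
  unfold hecke
  linear_combination (- (C tt * X i - X j)) * h

lemma hecke_eq_of_spec {i j : Fin n} (hij : i ≠ j) (f g : MvPolynomial (Fin n) K)
    (h : (X i - X j) * g =
      (1 - C tt) * (X j * f) + (C tt * (X i * swapVars i j f) - X j * swapVars i j f)) :
    hecke i j f = g := by
  apply mul_left_cancel₀ (X_sub_X_ne_zero hij)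
  rw [hecke_spec, h]

lemma swapVars_add (i j : Fin n) (f g : MvPolynomial (Fin n) K) :
    swapVars i j (f + g) = swapVars i j f + swapVars i j g := by simp [swapVars]

lemma hecke_eval (i j : Fin n) (f : MvPolynomial (Fin n) K) (x : Fin n → K) :
    (x i - x j) * eval x (hecke i j f) =
      (1 - tt) * (x j * eval x f) +
        (tt * x i - x j) * eval (x ∘ Equiv.swap i j) f := by
  have h := congrArg (eval x) (hecke_spec i j f)
  simp only [map_mul, map_sub, map_add, eval_X, eval_C, map_one, swapVars, eval_rename] at h
  rw [h]; ring

/-- If `T F = t F` then `F` is symmetric under the swap. -/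
lemma swap_eq_of_hecke {i j : Fin n} (hij : i ≠ j) (f : MvPolynomial (Fin n) K)
    (h : hecke i j f = C tt * f) : rename (Equiv.swap i j) f = f := by
  have h1 := exactDiv_spec i j f
  have h2 : (C tt * X i - X j) * exactDiv (f - swapVars i j f) (X i - X j) = 0 := by
    unfold hecke at h
    linear_combination (-1 : MvPolynomial (Fin n) K) * h
  have h3 : (C tt * X i - X j : MvPolynomial (Fin n) K) ≠ 0 := by
    intro h0
    have := congrArg (eval (fun k => if k = j then (1 : K) else 0)) h0
    simp [hij] at this
  rcases mul_eq_zero.mp h2 with h4 | h4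
  · exact absurd h4 h3
  · rw [h4, mul_zero] at h1
    exact (sub_eq_zero.mp h1.symm).symm

end Hecke

/-! ### Coefficients of the Hecke operator -/

section Coeff
variable {n : ℕ}

/-- The exponent equal to `τ` off `i, j` with entries `a, b` at `i, j`. -/
def ln (τ : Fin n → ℕ) (i j : Fin n) (a b : ℕ) : Fin n →₀ ℕ :=
  expOf (Function.update (Function.update τ i a) j b)

@[simp] lemma expOf_apply (τ : Fin n → ℕ) (k : Fin n) : expOf τ k = τ k := rfl

lemma expOf_coe (e : Fin n →₀ ℕ) : expOf (⇑e) = e := by ext k; rfl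

lemma ln_apply (τ : Fin n → ℕ) (i j : Fin n) (a b : ℕ) (k : Fin n) :
    ln τ i j a b k = if k = j then b else if k = i then a else τ k := by
  simp [ln, Function.update_apply]

lemma ln_self {τ : Fin n → ℕ} {i j : Fin n} : ln τ i j (τ i) (τ j) = expOf τ := by
  ext k
  rw [ln_apply]
  split_ifs with h1 h2
  · subst h1; rfl
  · subst h2; rfl
  · rfl

lemma coeff_ln_X_i_zero {i j : Fin n} (hij : i ≠ j) (τ : Fin n → ℕ) (b : ℕ)
    (g : MvPolynomial (Fin n) K) : coeff (ln τ i j 0 b) (X i * g) = 0 := by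
  rw [coeff_X_mul', if_neg]
  simp [ln_apply, hij]

lemma coeff_ln_X_j_zero {i j : Fin n} (τ : Fin n → ℕ) (a : ℕ)
    (g : MvPolynomial (Fin n) K) : coeff (ln τ i j a 0) (X j * g) = 0 := by
  rw [coeff_X_mul', if_neg]
  simp [ln_apply]

lemma coeff_ln_X_i_succ {i j : Fin n} (hij : i ≠ j) (τ : Fin n → ℕ) (a b : ℕ)
    (g : MvPolynomial (Fin n) K) :
    coeff (ln τ i j (a + 1) b) (X i * g) = coeff (ln τ i j a b) g := by
  have : ln τ i j (a + 1) b = Finsupp.single i 1 + ln τ i j a b := by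
    ext k
    rw [Finsupp.add_apply, ln_apply, ln_apply, Finsupp.single_apply]
    by_cases h1 : k = j
    · subst h1; simp [hij]
    · by_cases h2 : k = i
      · subst h2; simp [h1]; omega
      · simp [h1, h2, Ne.symm h2]
  rw [this, coeff_X_mul]

lemma coeff_ln_X_j_succ {i j : Fin n} (hij : i ≠ j) (τ : Fin n → ℕ) (a b : ℕ)
    (g : MvPolynomial (Fin n) K) :
    coeff (ln τ i j a (b + 1)) (X j * g) = coeff (ln τ i j a b) g := by
  have : ln τ i j a (b + 1) = Finsupp.single j 1 + ln τ i j a b := by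
    ext k
    rw [Finsupp.add_apply, ln_apply, ln_apply, Finsupp.single_apply]
    by_cases h1 : k = j
    · subst h1; simp; omega
    · simp [h1, Ne.symm h1]
  rw [this, coeff_X_mul]

lemma coeff_ln_swap {i j : Fin n} (hij : i ≠ j) (τ : Fin n → ℕ) (a b : ℕ)
    (g : MvPolynomial (Fin n) K) :
    coeff (ln τ i j a b) (swapVars i j g) = coeff (ln τ i j b a) g := by
  unfold swapVars
  rw [← coeff_rename_mapDomain _ (Equiv.swap i j).injective g (ln τ i j b a)]
  congr 1
  ext k
  have : k = Equiv.swap i j (Equiv.swap i j k) := by simp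
  conv_rhs => rw [this]
  rw [Finsupp.mapDomain_apply (Equiv.swap i j).injective, ln_apply, ln_apply]
  by_cases h1 : k = j
  · subst h1; simp [hij]
  · by_cases h2 : k = i
    · subst h2; simp [h1]
    · rw [Equiv.swap_apply_of_ne_of_ne h2 h1]; simp [h1, h2]

lemma hecke_coeff_aux {i j : Fin n} (hij : i ≠ j) (τ : Fin n → ℕ) (s : ℕ)
    (f : MvPolynomial (Fin n) K) (F : ℕ → K) (hF : ∀ k, F k = coeff (ln τ i j k (s - k)) f) :
    ∀ a, a ≤ s → coeff (ln τ i j a (s - a)) (hecke i j f) =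
      (tt - 1) * ∑ k ∈ Finset.range (a + 1), F k +
        (1 - tt) * ∑ k ∈ Finset.range a, F (s - k) + F (s - a) := by
  have hspec : ∀ e, coeff e (X i * hecke i j f) - coeff e (X j * hecke i j f) =
      (1 - tt) * coeff e (X j * f) + (tt * coeff e (X i * swapVars i j f) -
        coeff e (X j * swapVars i j f)) := by
    intro e
    have h := congrArg (coeff e) (hecke_spec i j f)
    have e1 : (1 - C tt : MvPolynomial (Fin n) K) = C (1 - tt) := by simp
    rw [e1, sub_mul] at h
    simpa only [coeff_sub, coeff_add, coeff_C_mul] using h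
  intro a
  induction a with
  | zero =>
    intro _
    have h := hspec (ln τ i j 0 (s + 1))
    rw [coeff_ln_X_i_zero hij, coeff_ln_X_i_zero hij, coeff_ln_X_j_succ hij,
      coeff_ln_X_j_succ hij, coeff_ln_X_j_succ hij, coeff_ln_swap hij] at h
    simp only [zero_add, Finset.sum_range_one, Finset.range_zero, Finset.sum_empty, Nat.sub_zero]
    rw [hF, hF]
    simp only [Nat.sub_zero, Nat.sub_self]
    linear_combination (-1 : K) * h
  | succ a ih =>
    intro ha
    have ih := ih (by omega)
    obtain ⟨b, rfl⟩ : ∃ b, s = a + 1 + b := ⟨s - (a + 1), by omega⟩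
    have h := hspec (ln τ i j (a + 1) (b + 1))
    rw [coeff_ln_X_i_succ hij, coeff_ln_X_i_succ hij, coeff_ln_X_j_succ hij,
      coeff_ln_X_j_succ hij, coeff_ln_X_j_succ hij, coeff_ln_swap hij, coeff_ln_swap hij] at h
    have e1 : a + 1 + b - a = b + 1 := by omega
    have e2 : a + 1 + b - (a + 1) = b := by omega
    rw [e1] at ih
    rw [e2, Finset.sum_range_succ F (a + 1), Finset.sum_range_succ (fun k => F (a + 1 + b - k)) a,
      e1]
    have h1 := hF (a + 1)
    have h2 := hF (b + 1)
    have h3 := hF b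
    rw [e2] at h1
    rw [show a + 1 + b - (b + 1) = a by omega] at h2
    rw [show a + 1 + b - b = a + 1 by omega] at h3
    rw [← h1, ← h2, ← h3] at h
    linear_combination ih - h

/-- Telescoped symmetric form. -/
lemma hecke_coeff {i j : Fin n} (hij : i ≠ j) (τ : Fin n → ℕ)
    (f : MvPolynomial (Fin n) K) :
    coeff (expOf τ) (hecke i j f) =
      (tt - 1) * ∑ k ∈ Finset.range (τ i + 1), coeff (ln τ i j k (τ i + τ j - k)) f +
        (1 - tt) * ∑ k ∈ Finset.range (τ i),
          coeff (ln τ i j (τ i + τ j - k) k) f + coeff (ln τ i j (τ j) (τ i)) f := by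
  have h := hecke_coeff_aux hij τ (τ i + τ j) f _ (fun k => rfl) (τ i) (by omega)
  rw [Nat.add_sub_cancel_left, ln_self] at h
  rw [h]
  congr 2
  · congr 1
    apply Finset.sum_congr rfl
    intro k hk
    rw [Finset.mem_range] at hk
    rw [show τ i + τ j - (τ i + τ j - k) = k by omega]
  · rw [show τ i + τ j - τ j = τ i by omega]

/-- The reduced formula when there are no contributions of strictly wider exponents. -/
lemma hecke_coeff_reduced {i j : Fin n} (hij : i ≠ j) (τ : Fin n → ℕ)
    (f : MvPolynomial (Fin n) K)
    (h0 : ∀ a b, a + b = τ i + τ j → min a b < min (τ i) (τ j) →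
      coeff (ln τ i j a b) f = 0) :
    coeff (expOf τ) (hecke i j f) =
      if τ i = τ j then tt * coeff (expOf τ) f
      else if τ i < τ j then coeff (ln τ i j (τ j) (τ i)) f + (tt - 1) * coeff (expOf τ) f
      else tt * coeff (ln τ i j (τ j) (τ i)) f := by
  rw [hecke_coeff hij]
  by_cases hle : τ i ≤ τ j
  · have s1 : ∑ k ∈ Finset.range (τ i), coeff (ln τ i j (τ i + τ j - k) k) f = 0 := by
      apply Finset.sum_eq_zero
      intro k hk
      rw [Finset.mem_range] at hk
      apply h0 <;> omega
    have s2 : ∑ k ∈ Finset.range (τ i), coeff (ln τ i j k (τ i + τ j - k)) f = 0 := by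
      apply Finset.sum_eq_zero
      intro k hk
      rw [Finset.mem_range] at hk
      apply h0 <;> omega
    rw [Finset.sum_range_succ, s1, s2, Nat.add_sub_cancel_left, ln_self]
    split_ifs with h1 h2
    · have : ln τ i j (τ j) (τ i) = expOf τ := by
        conv_rhs => rw [← ln_self (τ := τ) (i := i) (j := j)]
        rw [h1]
      rw [this]; ring
    · ring
    · omega
  · rw [if_neg (by omega), if_neg (by omega)]
    have s1 : ∑ k ∈ Finset.range (τ i + 1), coeff (ln τ i j k (τ i + τ j - k)) f =
        ∑ k ∈ Finset.range (τ i), coeff (ln τ i j (τ i + τ j - k) k) f +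
          coeff (ln τ i j (τ j) (τ i)) f := by
      rw [← Finset.sum_range_reflect]
      simp only [Nat.add_sub_cancel]
      -- both sums reduce to the interval between the entries
      have hs : ∀ k ∈ Finset.range (τ i + 1), coeff (ln τ i j (τ i - k) (τ i + τ j - (τ i - k))) f =
          coeff (ln τ i j (τ i - k) (τ j + k)) f := by
        intro k hk
        rw [Finset.mem_range] at hk
        rw [show τ i + τ j - (τ i - k) = τ j + k by omega]
      rw [Finset.sum_congr rfl hs]
      obtain ⟨c, hc⟩ : ∃ c, τ i = τ j + c := ⟨τ i - τ j, by omega⟩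
      have hc0 : 0 < c := by omega
      have a1 : ∑ k ∈ Finset.range (τ i + 1), coeff (ln τ i j (τ i - k) (τ j + k)) f =
          ∑ k ∈ Finset.range (c + 1), coeff (ln τ i j (τ i - k) (τ j + k)) f := by
        symm
        apply Finset.sum_subset
        · intro k; simp only [Finset.mem_range]; omega
        · intro k hk hk2
          simp only [Finset.mem_range] at hk hk2
          apply h0 <;> omega
      have a2 : ∑ k ∈ Finset.range (τ i), coeff (ln τ i j (τ i + τ j - k) k) f =
          ∑ k ∈ Finset.range c, coeff (ln τ i j (τ i - k) (τ j + k)) f := by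
        rw [hc, Finset.sum_range_add, Finset.sum_eq_zero, zero_add]
        · apply Finset.sum_congr rfl
          intro k hk
          rw [show τ j + c + τ j - (τ j + k) = τ j + c - k by
            rw [Finset.mem_range] at hk; omega]
        · intro k hk
          rw [Finset.mem_range] at hk
          apply h0 <;> omega
      rw [a1, a2, Finset.sum_range_succ, show τ i - c = τ j by omega,
        show τ j + c = τ i by omega]
    rw [s1]; ring

/-- Support of the Hecke operator. -/
lemma hecke_support {i j : Fin n} (hij : i ≠ j) (τ : Fin n → ℕ)
    (f : MvPolynomial (Fin n) K) (h : coeff (expOf τ) (hecke i j f) ≠ 0) :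
    ∃ a b, a + b = τ i + τ j ∧ min a b ≤ min (τ i) (τ j) ∧ coeff (ln τ i j a b) f ≠ 0 := by
  by_contra! hcon
  apply h
  rw [hecke_coeff_reduced hij τ f (fun a b h1 h2 => hcon a b h1 h2.le)]
  have h1 := hcon (τ i) (τ j) rfl le_rfl
  have h2 := hcon (τ j) (τ i) (by omega) (by omega)
  rw [ln_self] at h1
  rw [h1, h2]
  simp

end Coeff

/-! ### Combinatorics of compositions -/

section Combi
variable {n : ℕ}

lemma sum_split {M : Type*} [AddCommMonoid M] {a b : Fin n} (hab : a ≠ b) (g : Fin n → M) :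
    ∑ i, g i = g a + g b + ∑ i ∈ Finset.univ.filter (fun i => i ≠ a ∧ i ≠ b), g i := by
  have h1 := Finset.sum_filter_add_sum_filter_not Finset.univ (fun i => i ≠ a ∧ i ≠ b) g
  rw [← h1, add_comm]
  congr 1
  have : Finset.univ.filter (fun i => ¬ (i ≠ a ∧ i ≠ b)) = {a, b} := by
    ext i; simp only [Finset.mem_filter, Finset.mem_univ, true_and, Finset.mem_insert,
      Finset.mem_singleton]; tauto
  rw [this, Finset.sum_pair hab]

/-- Number of beads beyond a given position. -/
def NN (m r : ℕ) (ν : Fin n → ℕ) : ℕ := ∑ i, (ν i - m - if i.val < r then 1 else 0)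

/-- The (affine Bruhat type) order. -/
def ble (ν κ : Fin n → ℕ) : Prop :=
  csize ν = csize κ ∧ ∀ m r, r ≤ n → NN m r ν ≤ NN m r κ

lemma ble_refl (ν : Fin n → ℕ) : ble ν ν := ⟨rfl, fun _ _ _ => le_rfl⟩

lemma csize_swap (a b : Fin n) (ν : Fin n → ℕ) : csize (ν ∘ Equiv.swap a b) = csize ν :=
  Equiv.sum_comp (Equiv.swap a b) ν

lemma csize_permAct (σ : Equiv.Perm (Fin n)) (ν : Fin n → ℕ) : csize (permAct σ ν) = csize ν :=
  Equiv.sum_comp σ.symm ν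

lemma csize_eq_of_off {a b : Fin n} (hab : a ≠ b) (η ν : Fin n → ℕ)
    (hoff : ∀ i, i ≠ a → i ≠ b → η i = ν i) (hs : η a + η b = ν a + ν b) :
    csize η = csize ν := by
  unfold csize
  rw [sum_split hab η, sum_split hab ν, hs]
  congr 1
  apply Finset.sum_congr rfl
  intro i hi
  simp at hi
  exact hoff i hi.1 hi.2

lemma ble_swap {a b : Fin n} (hab : b.val = a.val + 1) (κ ν η : Fin n → ℕ) (hκ : κ b ≤ κ a)
    (h : ble ν κ) (hoff : ∀ i, i ≠ a → i ≠ b → η i = ν i) (hs : η a + η b = ν a + ν b)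
    (hm : min (ν a) (ν b) ≤ min (η a) (η b)) : ble η (κ ∘ Equiv.swap a b) := by
  have hne : a ≠ b := by intro h; rw [h] at hab; omega
  refine ⟨?_, ?_⟩
  · rw [csize_swap, csize_eq_of_off hne η ν hoff hs, h.1]
  · intro m r hr
    have key : ∀ (θ : Fin n → ℕ) (r : ℕ), NN m r θ =
      (θ a - m - if a.val < r then 1 else 0) + (θ b - m - if b.val < r then 1 else 0) +
        ∑ i ∈ Finset.univ.filter (fun i => i ≠ a ∧ i ≠ b),
          (θ i - m - if i.val < r then 1 else 0) := fun θ r => sum_split hne _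
    have c1 : ∀ r, ∑ i ∈ Finset.univ.filter (fun i => i ≠ a ∧ i ≠ b),
          (η i - m - if i.val < r then 1 else 0) =
        ∑ i ∈ Finset.univ.filter (fun i => i ≠ a ∧ i ≠ b),
          (ν i - m - if i.val < r then 1 else 0) := by
      intro r
      apply Finset.sum_congr rfl
      intro i hi
      simp at hi
      rw [hoff i hi.1 hi.2]
    have c2 : ∀ r, ∑ i ∈ Finset.univ.filter (fun i => i ≠ a ∧ i ≠ b),
          ((κ ∘ Equiv.swap a b) i - m - if i.val < r then 1 else 0) =
        ∑ i ∈ Finset.univ.filter (fun i => i ≠ a ∧ i ≠ b),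
          (κ i - m - if i.val < r then 1 else 0) := by
      intro r
      apply Finset.sum_congr rfl
      intro i hi
      simp at hi
      rw [Function.comp_apply, Equiv.swap_apply_of_ne_of_ne hi.1 hi.2]
    rw [key η, key (κ ∘ Equiv.swap a b), c1, c2, Function.comp_apply, Function.comp_apply,
      Equiv.swap_apply_left, Equiv.swap_apply_right]
    by_cases hra : r = a.val + 1
    · have c3 : ∀ θ : Fin n → ℕ, ∀ r', (r' = a.val ∨ r' = a.val + 2) →
          ∑ i ∈ Finset.univ.filter (fun i => i ≠ a ∧ i ≠ b),
          (θ i - m - if i.val < r' then 1 else 0) =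
        ∑ i ∈ Finset.univ.filter (fun i => i ≠ a ∧ i ≠ b),
          (θ i - m - if i.val < r then 1 else 0) := by
        intro θ r' hr'
        apply Finset.sum_congr rfl
        intro i hi
        simp only [Finset.mem_filter, Finset.mem_univ, true_and, Ne, Fin.ext_iff] at hi
        congr 1
        have : (i.val < r') ↔ (i.val < r) := by omega
        simp [this]
      have hb := b.isLt
      have h1 := h.2 m a.val (by omega)
      have h2 := h.2 m (a.val + 2) (by omega)
      rw [key ν, key κ, c3 ν _ (Or.inl rfl), c3 κ _ (Or.inl rfl)] at h1
      rw [key ν, key κ, c3 ν _ (Or.inr rfl), c3 κ _ (Or.inr rfl)] at h2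
      generalize (∑ i ∈ Finset.univ.filter (fun i => i ≠ a ∧ i ≠ b),
          (ν i - m - if i.val < r then 1 else 0)) = A at *
      generalize (∑ i ∈ Finset.univ.filter (fun i => i ≠ a ∧ i ≠ b),
          (κ i - m - if i.val < r then 1 else 0)) = B at *
      simp only [hra, hab, lt_irrefl, if_false, if_true, show a.val < a.val + 1 by omega,
        show a.val < a.val + 2 by omega, show ¬ (a.val + 1 < a.val) by omega,
        show (a.val + 1 < a.val + 2) by omega] at h1 h2 ⊢
      omega
    · have h1 := h.2 m r hr
      rw [key ν, key κ] at h1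
      generalize (∑ i ∈ Finset.univ.filter (fun i => i ≠ a ∧ i ≠ b),
          (ν i - m - if i.val < r then 1 else 0)) = A at *
      generalize (∑ i ∈ Finset.univ.filter (fun i => i ≠ a ∧ i ≠ b),
          (κ i - m - if i.val < r then 1 else 0)) = B at *
      by_cases hlt : a.val < r
      · have hlt2 : b.val < r := by omega
        simp only [hlt, hlt2, if_true] at h1 ⊢
        omega
      · have hlt2 : ¬ b.val < r := by omega
        simp only [hlt, hlt2, if_false] at h1 ⊢
        omega

lemma not_ble_swap {a b : Fin n} (hab : b.val = a.val + 1) (κ : Fin n → ℕ) (hκ : κ b < κ a) :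
    ¬ ble (κ ∘ Equiv.swap a b) κ := by
  intro h
  have hne : a ≠ b := by intro h; rw [h] at hab; omega
  have hb := b.isLt
  have h1 := h.2 (κ b) (a.val + 1) (by omega)
  unfold NN at h1
  rw [sum_split hne, sum_split hne (fun i => κ i - κ b - if i.val < a.val + 1 then 1 else 0)] at h1
  have c2 : ∑ i ∈ Finset.univ.filter (fun i => i ≠ a ∧ i ≠ b),
          ((κ ∘ Equiv.swap a b) i - κ b - if i.val < a.val + 1 then 1 else 0) =
        ∑ i ∈ Finset.univ.filter (fun i => i ≠ a ∧ i ≠ b),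
          (κ i - κ b - if i.val < a.val + 1 then 1 else 0) := by
      apply Finset.sum_congr rfl
      intro i hi
      simp at hi
      rw [Function.comp_apply, Equiv.swap_apply_of_ne_of_ne hi.1 hi.2]
  rw [c2, Function.comp_apply, Function.comp_apply,
      Equiv.swap_apply_left, Equiv.swap_apply_right] at h1
  simp only [hab, lt_irrefl, if_false, if_true, show a.val < a.val + 1 by omega] at h1
  omega

/-- Inversions of a composition. -/
def inv (ν : Fin n → ℕ) : ℕ :=
  (Finset.univ.filter fun p : Fin n × Fin n => p.1 < p.2 ∧ ν p.1 < ν p.2).card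

lemma inv_swap {a b : Fin n} (hab : b.val = a.val + 1) (ν : Fin n → ℕ) :
    ∃ c, inv ν = c + (if ν a < ν b then 1 else 0) ∧
      inv (ν ∘ Equiv.swap a b) = c + (if ν b < ν a then 1 else 0) := by
  have hlt : a < b := by rw [Fin.lt_def]; omega
  have hne : a ≠ b := hlt.ne
  let P : (Fin n → ℕ) → Finset (Fin n × Fin n) := fun ν =>
    Finset.univ.filter fun p : Fin n × Fin n => (p.1 < p.2 ∧ ν p.1 < ν p.2) ∧ p ≠ (a, b)
  have h1 : ∀ ν, inv ν = (P ν).card + (if ν a < ν b then 1 else 0) := by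
    intro ν
    unfold inv
    rw [← Finset.card_filter_add_card_filter_not (fun p => p ≠ (a, b))]
    rw [Finset.filter_filter, Finset.filter_filter]
    congr 1
    split_ifs with h
    · rw [Finset.card_eq_one]
      refine ⟨(a, b), ?_⟩
      ext p
      simp only [Finset.mem_filter, Finset.mem_univ, true_and, Finset.mem_singleton, not_not]
      constructor
      · exact fun h => h.2
      · rintro rfl; exact ⟨⟨hlt, h⟩, rfl⟩
    · rw [Finset.card_eq_zero]
      ext p
      simp only [Finset.mem_filter, Finset.mem_univ, true_and, not_not]
      constructor
      · rintro ⟨⟨_, h3⟩, rfl⟩; exact absurd h3 h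
      · intro h; simp at h
  have hord : ∀ p : Fin n × Fin n, p.1 < p.2 → p ≠ (a, b) →
      Equiv.swap a b p.1 < Equiv.swap a b p.2 ∧
      (Equiv.swap a b p.1, Equiv.swap a b p.2) ≠ (a, b) := by
    rintro ⟨x, y⟩ hxy hp
    simp only [Ne, Prod.mk.injEq, Fin.ext_iff, Fin.lt_def, Equiv.swap_apply_def] at *
    split_ifs <;> omega
  have h2 : (P (ν ∘ Equiv.swap a b)).card = (P ν).card := by
    apply Finset.card_nbij' (fun p => (Equiv.swap a b p.1, Equiv.swap a b p.2))
      (fun p => (Equiv.swap a b p.1, Equiv.swap a b p.2))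
    · intro p hp
      simp only [P, Finset.coe_filter, Finset.mem_univ, true_and, Set.mem_ofPred_eq] at hp ⊢
      have := hord p hp.1.1 hp.2
      exact ⟨⟨this.1, hp.1.2⟩, this.2⟩
    · intro p hp
      simp only [P, Finset.coe_filter, Finset.mem_univ, true_and, Set.mem_ofPred_eq] at hp ⊢
      have := hord p hp.1.1 hp.2
      refine ⟨⟨this.1, ?_⟩, this.2⟩
      simpa using hp.1.2
    · intro p _; simp
    · intro p _; simp
  refine ⟨(P ν).card, h1 ν, ?_⟩
  rw [h1, h2]
  simp

lemma permAct_mul (σ τ : Equiv.Perm (Fin n)) (ν : Fin n → ℕ) :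
    permAct (σ * τ) ν = permAct σ (permAct τ ν) := rfl

lemma permAct_one (ν : Fin n → ℕ) : permAct 1 ν = ν := rfl

/-- lower index of the adjacent pair -/
def ia (i : {i : ℕ // i + 1 < n}) : Fin n := ⟨i.1, Nat.lt_of_succ_lt i.2⟩
/-- upper index of the adjacent pair -/
def ib (i : {i : ℕ // i + 1 < n}) : Fin n := ⟨i.1 + 1, i.2⟩

lemma iab (i : {i : ℕ // i + 1 < n}) : (ib i).val = (ia i).val + 1 := rfl

lemma ia_ne_ib (i : {i : ℕ // i + 1 < n}) : ia i ≠ ib i := by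
  intro h
  have := iab i
  rw [h] at this
  omega

lemma permAct_adjSwap (i : {i : ℕ // i + 1 < n}) (ν : Fin n → ℕ) :
    permAct (adjSwap i) ν = ν ∘ Equiv.swap (ia i) (ib i) := rfl

lemma swap_swap_comp (a b : Fin n) (ν : Fin n → ℕ) :
    (ν ∘ Equiv.swap a b) ∘ Equiv.swap a b = ν := by
  ext k; simp

lemma isPartition_of_adj (μ : Fin n → ℕ)
    (h : ∀ i : {i : ℕ // i + 1 < n}, μ (ib i) ≤ μ (ia i)) : IsPartition μ := by
  have key : ∀ d : ℕ, ∀ i j : Fin n, j.val = i.val + d → μ j ≤ μ i := by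
    intro d
    induction d with
    | zero =>
      intro i j hij
      have : i = j := Fin.ext (by omega)
      rw [this]
    | succ d ih =>
      intro i j hij
      have hj := j.isLt
      have h1 := ih i ⟨i.val + d, by omega⟩ rfl
      have h2 := h ⟨i.val + d, by omega⟩
      have e : ib ⟨i.val + d, by omega⟩ = j := Fin.ext (by simp only [ib]; omega)
      rw [e] at h2
      exact h2.trans h1
  intro i j hij
  exact key (j.val - i.val) i j (by rw [Fin.le_def] at hij; omega)

lemma inv_partition {l : Fin n → ℕ} (hl : IsPartition l) : inv l = 0 := by
  unfold inv
  rw [Finset.card_eq_zero]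
  ext p
  simp only [Finset.mem_filter, Finset.mem_univ, true_and]
  constructor
  · rintro ⟨h1, h2⟩
    have := hl _ _ h1.le
    omega
  · intro h; simp at h

lemma exists_word (N : ℕ) : ∀ μ : Fin n → ℕ, inv μ = N →
    ∃ l : Fin n → ℕ, ∃ w : List {i : ℕ // i + 1 < n}, IsPartition l ∧ w.length = inv μ ∧
      permAct (w.map adjSwap).prod l = μ := by
  induction N with
  | zero =>
    intro μ hμ
    refine ⟨μ, [], ?_, by simp [hμ], rfl⟩
    apply isPartition_of_adj
    intro i
    by_contra! hc
    obtain ⟨c, h1, _⟩ := inv_swap (iab i) μ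
    rw [if_pos hc] at h1
    omega
  | succ N ih =>
    intro μ hμ
    have : ∃ i : {i : ℕ // i + 1 < n}, μ (ia i) < μ (ib i) := by
      by_contra! hc
      have := inv_partition (isPartition_of_adj μ hc)
      omega
    obtain ⟨i, hi⟩ := this
    obtain ⟨c, h1, h2⟩ := inv_swap (iab i) μ
    rw [if_pos hi] at h1
    rw [if_neg (by omega)] at h2
    obtain ⟨l, w, hl, hw, hp⟩ := ih (μ ∘ Equiv.swap (ia i) (ib i)) (by omega)
    refine ⟨l, i :: w, hl, by simp; omega, ?_⟩
    rw [List.map_cons, List.prod_cons, permAct_mul, hp, permAct_adjSwap, swap_swap_comp]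

lemma partition_unique {l l' : Fin n → ℕ} (hl : IsPartition l) (hl' : IsPartition l')
    (σ : Equiv.Perm (Fin n)) (h : permAct σ l = l') : l = l' := by
  have h1 : Monotone ((OrderDual.toDual ∘ l) ∘ (1 : Equiv.Perm (Fin n))) := by
    intro i j hij
    exact hl i j hij
  have h2 : Monotone ((OrderDual.toDual ∘ l) ∘ σ.symm) := by
    intro i j hij
    have := hl' i j hij
    rw [← h] at this
    exact this
  have h3 := Tuple.unique_monotone h1 h2
  rw [← h]
  funext k
  exact OrderDual.toDual.injective (congrFun h3 k)

lemma exists_word' {l : Fin n → ℕ} (hl : IsPartition l) (σ : Equiv.Perm (Fin n)) :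
    ∃ w : List {i : ℕ // i + 1 < n}, w.length = inv (permAct σ l) ∧
      permAct (w.map adjSwap).prod l = permAct σ l := by
  obtain ⟨l', w, hl', hw, hp⟩ := exists_word _ (permAct σ l) rfl
  have : l = l' := by
    apply partition_unique hl hl' ((w.map adjSwap).prod⁻¹ * σ)
    rw [permAct_mul, ← hp, ← permAct_mul, inv_mul_cancel, permAct_one]
  subst this
  exact ⟨w, hw, hp⟩

/-- The staircase. -/
def stair (n : ℕ) : Fin n → ℕ := fun i => n - 1 - i.val

lemma stair_partition : IsPartition (stair n) := by
  intro i j hij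
  rw [Fin.le_def] at hij
  unfold stair
  omega

lemma stair_inj : Function.Injective (stair n) := by
  intro i j hij
  unfold stair at hij
  have := i.isLt
  have := j.isLt
  exact Fin.ext (by omega)

lemma permAct_stair_inj {σ τ : Equiv.Perm (Fin n)}
    (h : permAct σ (stair n) = permAct τ (stair n)) : σ = τ := by
  have : σ.symm = τ.symm := by
    ext k
    exact congrArg _ (stair_inj (congrFun h k))
  rw [← Equiv.symm_symm σ, this, Equiv.symm_symm]

lemma permLength_eq (σ : Equiv.Perm (Fin n)) : permLength σ = inv (permAct σ (stair n)) := by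
  unfold permLength inv
  rw [Set.ncard_eq_toFinset_card']
  apply Finset.card_nbij' (fun p => (σ p.2, σ p.1)) (fun p => (σ.symm p.2, σ.symm p.1))
  · intro p hp
    have hp' : p.1 < p.2 ∧ σ p.2 < σ p.1 := by simpa using hp
    apply Finset.mem_coe.mpr
    refine Finset.mem_filter.mpr ⟨Finset.mem_univ _, hp'.2, ?_⟩
    have h1 := hp'.1
    have h2 := p.2.isLt
    rw [Fin.lt_def] at h1
    simp only [permAct, Function.comp_apply, Equiv.symm_apply_apply, stair]
    omega
  · intro p hp
    obtain ⟨h1, h2⟩ := (Finset.mem_filter.mp (Finset.mem_coe.mp hp)).2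
    simp only [permAct, Function.comp_apply, stair] at h2
    have h3 : σ.symm p.2 < σ.symm p.1 := by
      rw [Fin.lt_def]
      omega
    simpa using ⟨h3, h1⟩
  · intro p _; simp
  · intro p _; simp

lemma inv_word_le (l : Fin n → ℕ) (w : List {i : ℕ // i + 1 < n}) :
    inv (permAct (w.map adjSwap).prod l) ≤ w.length + inv l := by
  induction w with
  | nil => simp [permAct_one]
  | cons i w ih =>
    rw [List.map_cons, List.prod_cons, permAct_mul, permAct_adjSwap]
    obtain ⟨c, h1, h2⟩ := inv_swap (iab i) (permAct (w.map adjSwap).prod l)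
    rw [h2, List.length_cons]
    split_ifs at * <;> omega

lemma exists_reduced (σ : Equiv.Perm (Fin n)) : ∃ w, IsReducedWordOf w σ := by
  obtain ⟨w, hw, hp⟩ := exists_word' (stair_partition (n := n)) σ
  refine ⟨w, permAct_stair_inj hp, ?_⟩
  rw [permLength_eq, hw]

/-- The data extracted from `sigmaMin` and `Tsigma`. -/
lemma sigmaMin_word {l : Fin n → ℕ} (hl : IsPartition l) (μ : Fin n → ℕ)
    (hμ : ∃ σ, permAct σ l = μ) :
    ∃ w : List {i : ℕ // i + 1 < n}, Tsigma (sigmaMin l μ) = Tword w ∧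
      permAct (w.map adjSwap).prod l = μ ∧ w.length ≤ inv μ := by
  obtain ⟨σ₀, hσ₀⟩ := hμ
  have hex : ∃ σ, permAct σ l = μ ∧ ∀ τ, permAct τ l = μ → permLength σ ≤ permLength τ := by
    obtain ⟨σ, hσ, hmin⟩ := Set.exists_min_image {σ | permAct σ l = μ} permLength
      (Set.toFinite _) ⟨σ₀, hσ₀⟩
    exact ⟨σ, hσ, hmin⟩
  have hspec : permAct (sigmaMin l μ) l = μ ∧
      ∀ τ, permAct τ l = μ → permLength (sigmaMin l μ) ≤ permLength τ := by
    unfold sigmaMin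
    rw [dif_pos hex]
    exact hex.choose_spec
  have hr := exists_reduced (sigmaMin l μ)
  have hw := hr.choose_spec
  refine ⟨hr.choose, ?_, ?_, ?_⟩
  · unfold Tsigma
    rw [dif_pos hr]
  · rw [hw.1]; exact hspec.1
  · rw [hw.2]
    obtain ⟨w', hw', hp'⟩ := exists_word' hl σ₀
    rw [hσ₀] at hw' hp'
    have h1 := hspec.2 _ hp'
    rw [permLength_eq (w'.map adjSwap).prod] at h1
    have h2 := inv_word_le (stair n) w'
    rw [inv_partition stair_partition] at h2
    omega

/-- Each step of a minimal word strictly increases the number of inversions. -/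
lemma word_step {l : Fin n → ℕ} (hl : IsPartition l) (i : {i : ℕ // i + 1 < n})
    (w : List {i : ℕ // i + 1 < n})
    (h : (i :: w).length ≤ inv (permAct ((i :: w).map adjSwap).prod l)) :
    w.length ≤ inv (permAct (w.map adjSwap).prod l) ∧
      permAct (w.map adjSwap).prod l (ib i) < permAct (w.map adjSwap).prod l (ia i) := by
  rw [List.map_cons, List.prod_cons, permAct_mul, permAct_adjSwap] at h
  have h0 := inv_word_le l w
  rw [inv_partition hl] at h0
  obtain ⟨c, h1, h2⟩ := inv_swap (iab i) (permAct (w.map adjSwap).prod l)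
  rw [h2, List.length_cons] at h
  split_ifs at * <;> omega

lemma sortDesc_eq {l : Fin n → ℕ} (hl : IsPartition l) (σ : Equiv.Perm (Fin n)) :
    sortDesc (permAct σ l) = l := by
  have h : ∃ l', IsPartition l' ∧ permAct σ l ∈ Sn l' := ⟨l, hl, σ, rfl⟩
  unfold sortDesc
  rw [dif_pos h]
  obtain ⟨h1, τ, hτ⟩ := h.choose_spec
  symm
  apply partition_unique hl h1 (τ⁻¹ * σ)
  rw [permAct_mul]
  have h2 := congrArg (permAct τ⁻¹) hτ
  rw [← permAct_mul, inv_mul_cancel, permAct_one] at h2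
  exact h2.symm

end Combi

/-! ### Evaluation points -/

section Eval
variable {n : ℕ}

lemma kstat_eq_sum (ν : Fin n → ℕ) (i : Fin n) :
    kstat ν i = ∑ j, if (j < i ∧ ν i < ν j) ∨ (i < j ∧ ν i ≤ ν j) then 1 else 0 := by
  unfold kstat
  rw [Set.ncard_eq_toFinset_card', Set.ncard_eq_toFinset_card', ← Finset.card_union_of_disjoint]
  · rw [← Finset.card_filter]
    congr 1
    ext j
    simp
  · rw [Finset.disjoint_left]
    intro j h1 h2
    simp at h1 h2
    exact absurd h1.1 (not_lt.mpr h2.1.le)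

lemma kstat_swap {a b : Fin n} (hab : b.val = a.val + 1) (ν : Fin n → ℕ) (hne : ν a ≠ ν b)
    (i : Fin n) : kstat (ν ∘ Equiv.swap a b) i = kstat ν (Equiv.swap a b i) := by
  rw [kstat_eq_sum, kstat_eq_sum, ← Equiv.sum_comp (Equiv.swap a b)]
  apply Finset.sum_congr rfl
  intro j _
  congr 1
  simp only [Function.comp_apply, Equiv.swap_apply_self, eq_iff_iff]
  have key : ∀ i' j' : Fin n, (i' ≠ a ∨ j' ≠ b) → (i' ≠ b ∨ j' ≠ a) →
      (Equiv.swap a b i' < Equiv.swap a b j' ↔ i' < j') := by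
    intro i' j' h1 h2
    simp only [Ne, Fin.ext_iff, Fin.lt_def, Equiv.swap_apply_def] at *
    split_ifs <;> omega
  obtain ⟨i, rfl⟩ := (Equiv.swap a b).surjective i
  simp only [Equiv.swap_apply_self]
  by_cases h1 : i = a ∧ j = b
  · obtain ⟨rfl, rfl⟩ := h1
    simp only [Equiv.swap_apply_left, Equiv.swap_apply_right, Fin.lt_def]
    omega
  · by_cases h2 : i = b ∧ j = a
    · obtain ⟨rfl, rfl⟩ := h2
      simp only [Equiv.swap_apply_left, Equiv.swap_apply_right, Fin.lt_def]
      omega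
    · rw [key i j (by tauto) (by tauto), key j i (by tauto) (by tauto)]

lemma evalPt_swap {a b : Fin n} (hab : b.val = a.val + 1) (ν : Fin n → ℕ) (hne : ν a ≠ ν b) :
    evalPt ν ∘ Equiv.swap a b = evalPt (ν ∘ Equiv.swap a b) := by
  funext i
  simp only [evalPt, Function.comp_apply]
  rw [kstat_swap hab ν hne]

lemma kstat_eq {a b : Fin n} (hab : b.val = a.val + 1) (ν : Fin n → ℕ) (he : ν a = ν b) :
    kstat ν a = kstat ν b + 1 := by
  have : (1 : ℕ) = ∑ j : Fin n, if j = b then 1 else 0 := by simp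
  rw [kstat_eq_sum, kstat_eq_sum, this, ← Finset.sum_add_distrib]
  apply Finset.sum_congr rfl
  intro j _
  rw [he]
  by_cases hj : j = b
  · subst hj
    simp [Fin.lt_def, hab]
  · by_cases hj2 : j = a
    · subst hj2
      simp [Fin.lt_def, hab, he, hj]
    · have h1 : j < a ↔ j < b := by
        simp only [Fin.ext_iff, Fin.lt_def] at *; omega
      have h2 : a < j ↔ b < j := by
        simp only [Fin.ext_iff, Fin.lt_def] at *; omega
      simp [h1, h2, hj]

lemma evalPt_eq {a b : Fin n} (hab : b.val = a.val + 1) (ν : Fin n → ℕ) (he : ν a = ν b) :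
    evalPt ν b = tt * evalPt ν a := by
  simp only [evalPt]
  rw [kstat_eq hab ν he, he]
  push_cast
  rw [neg_add, zpow_add₀ tt_ne_zero, zpow_neg_one]
  field_simp [tt_ne_zero]

lemma evalPt_ne {a b : Fin n} (ν : Fin n → ℕ) (hne : ν a ≠ ν b) : evalPt ν a ≠ evalPt ν b := by
  intro h
  exact hne (qt_inj _ _ _ _ h)

lemma evalPt_ne' {a b : Fin n} (ν : Fin n → ℕ) (hne : ν a ≠ ν b) :
    tt * evalPt ν a ≠ evalPt ν b := by
  intro h
  apply hne
  apply qt_inj _ _ (1 + -(kstat ν a : ℤ)) (-(kstat ν b : ℤ))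
  simp only [evalPt] at h
  rw [← h, zpow_add₀ tt_ne_zero, zpow_one]
  ring

lemma hecke_eval_eq {a b : Fin n} (hab : b.val = a.val + 1) (ν : Fin n → ℕ) (he : ν a = ν b)
    (f : MvPolynomial (Fin n) K) :
    eval (evalPt ν) (hecke a b f) = tt * eval (evalPt ν) f := by
  have h := hecke_eval a b f (evalPt ν)
  rw [evalPt_eq hab ν he] at h
  have h1 := evalPt_ne_zero ν a
  have h2 : (1 - tt) ≠ 0 := sub_ne_zero.mpr tt_ne_one.symm
  apply mul_left_cancel₀ (mul_ne_zero h2 h1)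
  linear_combination h

lemma hecke_eval_ne {a b : Fin n} (hab : b.val = a.val + 1) (ν : Fin n → ℕ) (hne : ν a ≠ ν b)
    (f : MvPolynomial (Fin n) K) :
    (evalPt ν a - evalPt ν b) * eval (evalPt ν) (hecke a b f) =
      (1 - tt) * (evalPt ν b * eval (evalPt ν) f) +
        (tt * evalPt ν a - evalPt ν b) * eval (evalPt (ν ∘ Equiv.swap a b)) f := by
  rw [hecke_eval, evalPt_swap hab ν hne]

lemma hecke_eval_zero {a b : Fin n} (hab : b.val = a.val + 1) (ν : Fin n → ℕ)
    (f : MvPolynomial (Fin n) K) (h1 : eval (evalPt ν) f = 0)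
    (h2 : eval (evalPt (ν ∘ Equiv.swap a b)) f = 0) :
    eval (evalPt ν) (hecke a b f) = 0 := by
  by_cases he : ν a = ν b
  · rw [hecke_eval_eq hab ν he, h1, mul_zero]
  · have h := hecke_eval_ne hab ν he f
    rw [h1, h2] at h
    simp only [mul_zero, add_zero] at h
    exact (mul_eq_zero.mp h).resolve_left (sub_ne_zero.mpr (evalPt_ne ν he))

/-! ### Degrees -/

lemma sum_coe_eq_csize (e : Fin n →₀ ℕ) : (e.sum fun _ k => k) = csize (⇑e) := by
  rw [Finsupp.sum_fintype _ _ (fun _ => rfl)]; rfl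

lemma totalDegree_le_iff' (f : MvPolynomial (Fin n) K) (d : ℕ) :
    f.totalDegree ≤ d ↔ ∀ ν : Fin n → ℕ, coeff (expOf ν) f ≠ 0 → csize ν ≤ d := by
  constructor
  · intro h ν hν
    have := le_totalDegree (mem_support_iff.mpr hν)
    rw [sum_coe_eq_csize] at this
    exact this.trans h
  · intro h
    unfold totalDegree
    apply Finset.sup_le
    intro e he
    rw [sum_coe_eq_csize]
    apply h
    rw [expOf_coe]
    exact mem_support_iff.mp he

lemma hecke_support' {a b : Fin n} (hne : a ≠ b) (τ : Fin n → ℕ)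
    (f : MvPolynomial (Fin n) K) (h : coeff (expOf τ) (hecke a b f) ≠ 0) :
    ∃ ν : Fin n → ℕ, coeff (expOf ν) f ≠ 0 ∧ (∀ i, i ≠ a → i ≠ b → τ i = ν i) ∧
      τ a + τ b = ν a + ν b ∧ min (ν a) (ν b) ≤ min (τ a) (τ b) := by
  obtain ⟨x, y, h1, h2, h3⟩ := hecke_support hne τ f h
  refine ⟨ln τ a b x y, ?_, ?_, ?_, ?_⟩
  · rw [expOf_coe]; exact h3
  · intro i hi hj
    rw [ln_apply, if_neg hj, if_neg hi]
  · rw [ln_apply, ln_apply, if_neg hne, if_pos rfl, if_pos rfl, h1]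
  · rw [ln_apply, ln_apply, if_neg hne, if_pos rfl, if_pos rfl]; exact h2

lemma hecke_totalDegree {a b : Fin n} (hne : a ≠ b) (f : MvPolynomial (Fin n) K) (d : ℕ)
    (h : f.totalDegree ≤ d) : (hecke a b f).totalDegree ≤ d := by
  rw [totalDegree_le_iff'] at *
  intro τ hτ
  obtain ⟨ν, h1, h2, h3, _⟩ := hecke_support' hne τ f hτ
  rw [csize_eq_of_off hne τ ν h2 h3]
  exact h ν h1

/-! ### Existence of the nonsymmetric interpolation polynomials -/

/-- A nonzero multiple of `E*_κ`, with triangularity. -/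
def Good (κ : Fin n → ℕ) (f : MvPolynomial (Fin n) K) : Prop :=
  f.totalDegree ≤ csize κ ∧
  (∀ ν : Fin n → ℕ, csize ν ≤ csize κ → ν ≠ κ → eval (evalPt ν) f = 0) ∧
  eval (evalPt κ) f ≠ 0 ∧ coeff (expOf κ) f ≠ 0 ∧
  ∀ ν : Fin n → ℕ, csize ν = csize κ → coeff (expOf ν) f ≠ 0 → ble ν κ

lemma csize_eq_zero {κ : Fin n → ℕ} (h : csize κ = 0) : κ = 0 := by
  funext i
  exact (Finset.sum_eq_zero_iff.mp h) i (Finset.mem_univ i)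

lemma good_zero {κ : Fin n → ℕ} (h : csize κ = 0) : Good κ 1 := by
  refine ⟨by simp, ?_, by simp, ?_, ?_⟩
  · intro ν h1 h2
    rw [csize_eq_zero h] at h2
    exact absurd (csize_eq_zero (by omega)) h2
  · rw [csize_eq_zero h]
    have : expOf (0 : Fin n → ℕ) = 0 := by ext; rfl
    rw [this]; simp
  · intro ν h1 _
    rw [csize_eq_zero h, csize_eq_zero (h1.trans h)]
    exact ble_refl _

lemma good_swap {a b : Fin n} (hab : b.val = a.val + 1) (κ : Fin n → ℕ) (hb : κ b = 0)
    (ha : 0 < κ a) (f : MvPolynomial (Fin n) K) (hf : Good κ f) :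
    ∃ g, Good (κ ∘ Equiv.swap a b) g := by
  have hne : a ≠ b := by intro h; rw [h] at hab; omega
  obtain ⟨h1, h2, h3, h4, h5⟩ := hf
  have hκ : κ ∘ Equiv.swap a b ≠ κ := by
    intro h
    have := congrFun h a
    simp at this
    omega
  let c : K := - (eval (evalPt κ) (hecke a b f) / eval (evalPt κ) f)
  refine ⟨hecke a b f + C c * f, ?_, ?_, ?_, ?_, ?_⟩
  · rw [csize_swap]
    refine (totalDegree_add _ _).trans (max_le (hecke_totalDegree hne f _ h1) ?_)
    refine (totalDegree_mul _ _).trans ?_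
    rw [totalDegree_C, zero_add]
    exact h1
  · intro ν hν hνκ
    rw [csize_swap] at hν
    by_cases he : ν = κ
    · subst he
      simp only [map_add, map_mul, eval_C, c]
      field_simp
      ring
    · have e1 := h2 ν hν he
      rw [map_add, map_mul, e1, mul_zero, add_zero]
      apply hecke_eval_zero hab ν f e1
      apply h2
      · rw [csize_swap]; exact hν
      · intro h
        apply hνκ
        rw [← h, swap_swap_comp]
  · have e1 := h2 (κ ∘ Equiv.swap a b) (csize_swap a b κ).le hκ
    rw [map_add, map_mul, e1, mul_zero, add_zero]
    have hx : (κ ∘ Equiv.swap a b) a ≠ (κ ∘ Equiv.swap a b) b := by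
      simp; omega
    have h := hecke_eval_ne hab _ hx f
    rw [e1, swap_swap_comp] at h
    simp only [mul_zero, zero_add] at h
    intro h0
    rw [h0, mul_zero] at h
    rcases mul_eq_zero.mp h.symm with h6 | h6
    · exact evalPt_ne' _ hx (sub_eq_zero.mp h6)
    · exact h3 h6
  · have e0 : coeff (expOf (κ ∘ Equiv.swap a b)) f = 0 := by
      by_contra hc
      exact not_ble_swap hab κ (by omega) (h5 _ (csize_swap a b κ) hc)
    rw [coeff_add, coeff_C_mul, e0, mul_zero, add_zero, hecke_coeff_reduced hne, e0]
    · have e1 : (κ ∘ Equiv.swap a b) a = 0 := by simp [hb]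
      have e2 : (κ ∘ Equiv.swap a b) b = κ a := by simp
      rw [e1, e2, if_neg (by omega), if_pos ha]
      have e3 : ln (κ ∘ Equiv.swap a b) a b (κ a) 0 = expOf κ := by
        ext k
        rw [ln_apply, expOf_apply]
        split_ifs with i1 i2
        · rw [i1, hb]
        · rw [i2]
        · rw [Function.comp_apply, Equiv.swap_apply_of_ne_of_ne i2 i1]
      rw [e3]
      simpa using h4
    · intro x y _ hxy
      simp [hb] at hxy
  · intro ν hν hc
    rw [csize_swap] at hν
    rw [coeff_add, coeff_C_mul] at hc
    by_cases hf0 : coeff (expOf ν) f = 0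
    · rw [hf0, mul_zero, add_zero] at hc
      obtain ⟨η, g1, g2, g3, g4⟩ := hecke_support' hne ν f hc
      have := csize_eq_of_off hne ν η g2 g3
      exact ble_swap hab κ η ν (by omega) (h5 η (by omega) g1) g2 g3 g4
    · exact ble_swap hab κ ν ν (by omega) (h5 ν hν hf0) (fun _ _ _ => rfl) rfl le_rfl

end Eval

/-! ### The affine step -/

section Affine
variable {N : ℕ}

/-- The inverse affine shift of a composition. -/
def sh (κ : Fin (N + 1) → ℕ) : Fin (N + 1) → ℕ :=
  fun i => κ (finRotate (N + 1) i) - if finRotate (N + 1) i = 0 then 1 else 0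

lemma rot_val (i : Fin (N + 1)) :
    (finRotate (N + 1) i).val = if i.val = N then 0 else i.val + 1 := by
  by_cases h : i.val = N
  · have : i = Fin.last N := Fin.ext h
    subst this
    simp
  · rw [if_neg h]
    exact coe_finRotate_of_ne_last (fun h' => h (by rw [h']; rfl))

lemma rot_eq_zero (i : Fin (N + 1)) : finRotate (N + 1) i = 0 ↔ i.val = N := by
  rw [Fin.ext_iff, rot_val]
  split_ifs with h <;> simp [h]

lemma csize_sh (κ : Fin (N + 1) → ℕ) (h : 0 < κ 0) : csize (sh κ) + 1 = csize κ := by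
  have e : (1 : ℕ) = ∑ i : Fin (N + 1), if finRotate (N + 1) i = 0 then 1 else 0 := by
    rw [Equiv.sum_comp (finRotate (N + 1)) (fun i => if i = 0 then 1 else 0)]
    simp
  unfold csize sh
  rw [← Equiv.sum_comp (finRotate (N + 1)) κ]
  refine Eq.trans (congrArg (fun z => _ + z) e) ?_
  rw [← Finset.sum_add_distrib]
  apply Finset.sum_congr rfl
  intro i _
  split_ifs with hi
  · rw [hi]; omega
  · omega

lemma sh_inj (κ τ : Fin (N + 1) → ℕ) (hκ : 0 < κ 0) (hτ : 0 < τ 0) (h : sh κ = sh τ) : κ = τ := by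
  funext k
  obtain ⟨i, rfl⟩ := (finRotate (N + 1)).surjective k
  have := congrFun h i
  unfold sh at this
  split_ifs at this with hi
  · rw [hi] at this ⊢; omega
  · omega

lemma NN_sh (m r : ℕ) (hr : r ≤ N) (κ : Fin (N + 1) → ℕ) :
    NN m (r + 1) κ = NN m r (sh κ) := by
  unfold NN sh
  rw [← Equiv.sum_comp (finRotate (N + 1))]
  apply Finset.sum_congr rfl
  intro i _
  have h1 := rot_val i
  have h2 := rot_eq_zero i
  by_cases hi : i.val = N
  · rw [if_pos hi] at h1
    have h3 : finRotate (N + 1) i = 0 := h2.mpr hi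
    rw [if_pos (by omega), if_pos h3, if_neg (by omega)]
    omega
  · rw [if_neg hi] at h1
    have h3 : ¬ finRotate (N + 1) i = 0 := fun h => hi (h2.mp h)
    rw [if_neg h3, h1]
    simp only [Nat.add_lt_add_iff_right]
    omega

lemma ble_of_sh (τ κ : Fin (N + 1) → ℕ) (hκ : 0 < κ 0) (hτ : 0 < τ 0) (h : ble (sh τ) (sh κ)) :
    ble τ κ := by
  have hs : csize τ = csize κ := by
    rw [← csize_sh κ hκ, ← csize_sh τ hτ, h.1]
  refine ⟨hs, ?_⟩
  have pos : ∀ m r, r ≤ N → NN m (r + 1) τ ≤ NN m (r + 1) κ := by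
    intro m r hr
    rw [NN_sh m r hr, NN_sh m r hr]
    exact h.2 m r (by omega)
  intro m r hr
  rcases r with _ | r
  · rcases m with _ | m
    · have : ∀ θ : Fin (N + 1) → ℕ, NN 0 0 θ = csize θ := by
        intro θ
        simp [NN, csize]
      rw [this, this, hs]
    · have : ∀ θ : Fin (N + 1) → ℕ, NN (m + 1) 0 θ = NN m (N + 1) θ := by
        intro θ
        unfold NN
        apply Finset.sum_congr rfl
        intro i _
        have := i.isLt
        rw [if_neg (by omega), if_pos this]
        omega
      rw [this, this]
      exact pos m N le_rfl
  · exact pos m r (by omega)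

lemma kstat_sh (κ : Fin (N + 1) → ℕ) (hκ : 0 < κ 0) (i : Fin (N + 1)) :
    kstat κ (finRotate (N + 1) i) = kstat (sh κ) i := by
  rw [kstat_eq_sum, kstat_eq_sum, ← Equiv.sum_comp (finRotate (N + 1))]
  apply Finset.sum_congr rfl
  intro j _
  congr 1
  rw [eq_iff_iff]
  unfold sh
  have hi1 := rot_val i
  have hi2 := rot_eq_zero i
  have hj1 := rot_val j
  have hj2 := rot_eq_zero j
  have := i.isLt
  have := j.isLt
  simp only [Fin.lt_def]
  by_cases hi : i.val = N <;> by_cases hj : j.val = N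
  · have e : i = j := Fin.ext (by omega)
    subst e
    simp
  · rw [if_pos hi] at hi1
    rw [if_neg hj] at hj1
    have h3 := hi2.mpr hi
    rw [if_pos h3, if_neg (fun h => hj (hj2.mp h)), hi1, hj1, h3]
    omega
  · rw [if_neg hi] at hi1
    rw [if_pos hj] at hj1
    have h3 := hj2.mpr hj
    rw [if_pos h3, if_neg (fun h => hi (hi2.mp h)), hi1, hj1, h3]
    omega
  · rw [if_neg hi] at hi1
    rw [if_neg hj] at hj1
    rw [if_neg (fun h => hi (hi2.mp h)), if_neg (fun h => hj (hj2.mp h)), hi1, hj1]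
    omega

/-- scaling factors -/
def vv (i : Fin (N + 1)) : K := if finRotate (N + 1) i = 0 then qq⁻¹ else 1

lemma vv_ne_zero (i : Fin (N + 1)) : vv i ≠ 0 := by
  unfold vv
  split_ifs
  · exact inv_ne_zero qq_ne_zero
  · exact one_ne_zero

lemma evalPt_sh (κ : Fin (N + 1) → ℕ) (hκ : 0 < κ 0) :
    (fun i => vv i * evalPt κ (finRotate (N + 1) i)) = evalPt (sh κ) := by
  funext i
  simp only [evalPt]
  rw [kstat_sh κ hκ, ← mul_assoc]
  congr 1
  unfold vv sh
  split_ifs with h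
  · rw [h]
    obtain ⟨k, hk⟩ : ∃ k, κ 0 = k + 1 := ⟨κ 0 - 1, by omega⟩
    rw [hk, pow_succ, Nat.add_sub_cancel, mul_comm, mul_assoc, mul_inv_cancel₀ qq_ne_zero, mul_one]
  · simp

/-- the scaling homomorphism -/
def scl (f : MvPolynomial (Fin (N + 1)) K) : MvPolynomial (Fin (N + 1)) K :=
  aeval (fun i => C (vv i) * X i) f

lemma scl_coeff (f : MvPolynomial (Fin (N + 1)) K) (e : Fin (N + 1) →₀ ℕ) :
    coeff e (scl f) = (∏ i, vv i ^ e i) * coeff e f := by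
  induction f using MvPolynomial.induction_on' with
  | monomial u a =>
    have : scl (monomial u a) = monomial u ((∏ i, vv i ^ u i) * a) := by
      unfold scl
      rw [aeval_monomial, monomial_eq (s := u), Finsupp.prod_fintype _ _ (fun _ => pow_zero _),
        Finsupp.prod_fintype _ _ (fun _ => pow_zero _)]
      simp only [mul_pow, Finset.prod_mul_distrib, algebraMap_eq, C_mul, map_prod, C_pow]
      ring
    rw [this, coeff_monomial, coeff_monomial]
    split_ifs with h
    · rw [h]
    · simp
  | add p q hp hq =>
    unfold scl at *
    rw [map_add, coeff_add, hp, hq, coeff_add]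
    ring

/-- the affine operator, without the linear factor -/
def phi (f : MvPolynomial (Fin (N + 1)) K) : MvPolynomial (Fin (N + 1)) K :=
  rename (finRotate (N + 1)) (scl f)

lemma phi_eval (f : MvPolynomial (Fin (N + 1)) K) (x : Fin (N + 1) → K) :
    eval x (phi f) = eval (fun i => vv i * x (finRotate (N + 1) i)) f := by
  unfold phi scl
  rw [eval_rename, aeval_def, ← coe_eval₂Hom, ← RingHom.comp_apply]
  congr 1
  apply ringHom_ext
  · intro r; simp
  · intro i; simp

lemma phi_coeff (f : MvPolynomial (Fin (N + 1)) K) (τ : Fin (N + 1) → ℕ) :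
    ∃ s : K, s ≠ 0 ∧ coeff (expOf τ) (phi f) = s * coeff (expOf (τ ∘ finRotate (N + 1))) f := by
  refine ⟨∏ i, vv i ^ (expOf (τ ∘ finRotate (N + 1)) i),
    Finset.prod_ne_zero_iff.mpr (fun i _ => pow_ne_zero _ (vv_ne_zero i)), ?_⟩
  rw [← scl_coeff]
  unfold phi
  have e : expOf τ =
      Finsupp.mapDomain (finRotate (N + 1)) (expOf (τ ∘ finRotate (N + 1))) := by
    ext k
    obtain ⟨i, rfl⟩ := (finRotate (N + 1)).surjective k
    rw [Finsupp.mapDomain_apply (finRotate (N + 1)).injective]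
    rfl
  rw [e, coeff_rename_mapDomain _ (finRotate (N + 1)).injective]

lemma good_affine (κ : Fin (N + 1) → ℕ) (hκ : 0 < κ 0) (f : MvPolynomial (Fin (N + 1)) K)
    (hf : Good (sh κ) f) : ∃ g, Good κ g := by
  obtain ⟨h1, h2, h3, h4, h5⟩ := hf
  have hcs := csize_sh κ hκ
  let c : K := tt ^ (-(N : ℤ))
  -- coefficients of the new polynomial
  have hdeg : ∀ τ : Fin (N + 1) → ℕ, coeff (expOf τ) (phi f) ≠ 0 → csize τ ≤ csize (sh κ) := by
    intro τ hτ
    obtain ⟨s, _, hs⟩ := phi_coeff f τ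
    rw [hs] at hτ
    have := (totalDegree_le_iff' f _).mp h1 _ (right_ne_zero_of_mul hτ)
    have e : csize (τ ∘ finRotate (N + 1)) = csize τ := Equiv.sum_comp (finRotate (N + 1)) τ
    omega
  have hX : ∀ τ : Fin (N + 1) → ℕ, ∃ s : K, s ≠ 0 ∧ coeff (expOf τ) (X 0 * phi f) =
      if 0 < τ 0 then s * coeff (expOf (sh τ)) f else 0 := by
    intro τ
    obtain ⟨s, hs0, hs⟩ := phi_coeff f (fun i => τ i - if i = 0 then 1 else 0)
    refine ⟨s, hs0, ?_⟩
    rw [coeff_X_mul']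
    by_cases h0 : 0 < τ 0
    · rw [if_pos h0, if_pos (by simp; omega)]
      have : expOf τ - Finsupp.single 0 1 = expOf (fun i => τ i - if i = 0 then 1 else 0) := by
        ext k
        simp [Finsupp.single_apply, eq_comm]
      rw [this, hs]
      rfl
    · rw [if_neg h0, if_neg (by simp; omega)]
  have hcoeff : ∀ τ, coeff (expOf τ) ((X 0 - C c) * phi f) =
      coeff (expOf τ) (X 0 * phi f) - c * coeff (expOf τ) (phi f) := by
    intro τ
    rw [sub_mul, coeff_sub, coeff_C_mul]
  have htop : ∀ τ, csize τ = csize κ → coeff (expOf τ) ((X 0 - C c) * phi f) =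
      coeff (expOf τ) (X 0 * phi f) := by
    intro τ hτ
    rw [hcoeff]
    have : coeff (expOf τ) (phi f) = 0 := by
      by_contra hc
      have := hdeg τ hc
      omega
    rw [this, mul_zero, sub_zero]
  have heval : ∀ ν, eval (evalPt ν) ((X 0 - C c) * phi f) =
      (evalPt ν 0 - c) * eval (fun i => vv i * evalPt ν (finRotate (N + 1) i)) f := by
    intro ν
    rw [map_mul, phi_eval, map_sub, eval_X, eval_C]
  refine ⟨(X 0 - C c) * phi f, ?_, ?_, ?_, ?_, ?_⟩
  · rw [totalDegree_le_iff']
    intro τ hτ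
    by_contra hlt
    apply hτ
    rw [hcoeff]
    have e1 : coeff (expOf τ) (phi f) = 0 := by
      by_contra hc
      have := hdeg τ hc
      omega
    obtain ⟨s, hs0, hs⟩ := hX τ
    rw [e1, hs]
    split_ifs with h0
    · have : coeff (expOf (sh τ)) f = 0 := by
        by_contra hc
        have := (totalDegree_le_iff' f _).mp h1 _ hc
        have := csize_sh τ h0
        omega
      rw [this]; simp
    · simp
  · intro ν hν hνκ
    rw [heval]
    by_cases h0 : 0 < ν 0
    · rw [evalPt_sh ν h0, h2 (sh ν), mul_zero]
      · have := csize_sh ν h0; omega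
      · intro h
        exact hνκ (sh_inj _ _ h0 hκ h)
    · have hk : kstat ν 0 = N := by
        rw [kstat_eq_sum, Fin.sum_univ_succ]
        have hν0 : ν 0 = 0 := by omega
        simp [hν0]
      have : evalPt ν 0 = c := by
        simp only [evalPt, c]
        rw [hk, show ν 0 = 0 by omega]
        simp
      rw [this, sub_self, zero_mul]
  · rw [heval, evalPt_sh κ hκ]
    refine mul_ne_zero (sub_ne_zero.mpr ?_) h3
    intro h
    have : κ 0 = 0 := by
      apply qt_inj _ _ (-(kstat κ 0 : ℤ)) (-(N : ℤ))
      rw [pow_zero, one_mul]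
      exact h
    omega
  · rw [htop κ rfl]
    obtain ⟨s, hs0, hs⟩ := hX κ
    rw [hs, if_pos hκ]
    exact mul_ne_zero hs0 h4
  · intro ν hν hc
    rw [htop ν hν] at hc
    obtain ⟨s, hs0, hs⟩ := hX ν
    rw [hs] at hc
    split_ifs at hc with h0
    · apply ble_of_sh _ _ hκ h0
      apply h5 _ _ (right_ne_zero_of_mul hc)
      have := csize_sh ν h0
      omega
    · exact absurd rfl hc

lemma good_exists_aux (d : ℕ) : ∀ M : ℕ, ∀ κ : Fin (N + 1) → ℕ, csize κ = d → inv κ = M →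
    ∃ f, Good κ f := by
  induction d with
  | zero => exact fun M κ h _ => ⟨1, good_zero h⟩
  | succ d ihd =>
    intro M
    induction M with
    | zero =>
      intro κ hd hM
      have h0 : 0 < κ 0 := by
        by_contra hc
        have hz : csize κ = 0 := by
          apply Finset.sum_eq_zero
          intro i _
          by_contra hi
          have : inv κ ≠ 0 := by
            unfold inv
            rw [Finset.card_ne_zero]
            refine ⟨(0, i), Finset.mem_filter.mpr ⟨Finset.mem_univ _, ?_, ?_⟩⟩
            · rw [Fin.pos_iff_ne_zero]
              rintro rfl
              omega
            · show κ 0 < κ i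
              omega
          exact this hM
        omega
      obtain ⟨f, hf⟩ := ihd _ (sh κ) (by have := csize_sh κ h0; omega) rfl
      exact good_affine κ h0 f hf
    | succ M ihM =>
      intro κ hd hM
      by_cases h0 : 0 < κ 0
      · obtain ⟨f, hf⟩ := ihd _ (sh κ) (by have := csize_sh κ h0; omega) rfl
        exact good_affine κ h0 f hf
      · have hex : ∃ i : {i : ℕ // i + 1 < N + 1}, κ (ia i) = 0 ∧ 0 < κ (ib i) := by
          by_contra! hc
          have hall : ∀ k : ℕ, ∀ hk : k < N + 1, κ ⟨k, hk⟩ = 0 := by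
            intro k
            induction k with
            | zero => intro hk; have : κ ⟨0, hk⟩ = κ 0 := rfl; omega
            | succ k ih =>
              intro hk
              have := hc ⟨k, hk⟩ (ih (by omega))
              have e : κ (ib ⟨k, hk⟩) = κ ⟨k + 1, hk⟩ := rfl
              omega
          have hz : csize κ = 0 := Finset.sum_eq_zero (fun i _ => hall i.val i.isLt)
          omega
        obtain ⟨i, hi1, hi2⟩ := hex
        obtain ⟨c, e1, e2⟩ := inv_swap (iab i) κ
        rw [if_pos (by omega)] at e1
        rw [if_neg (by omega)] at e2
        obtain ⟨f, hf⟩ := ihM (κ ∘ Equiv.swap (ia i) (ib i)) (by rw [csize_swap]; exact hd)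
          (by omega)
        have := good_swap (iab i) (κ ∘ Equiv.swap (ia i) (ib i)) (by simpa using hi1)
          (by simpa using hi2) f hf
        rw [swap_swap_comp] at this
        exact this

end Affine

lemma good_exists {n : ℕ} (hn : 1 ≤ n) (κ : Fin n → ℕ) : ∃ f, Good κ f := by
  obtain ⟨N, rfl⟩ : ∃ N, n = N + 1 := ⟨n - 1, by omega⟩
  exact good_exists_aux _ _ κ rfl rfl

/-! ### Unisolvence -/

lemma inj_of_surj {F V ι : Type*} [Field F] [AddCommGroup V] [Module F V] [Fintype ι]
    (e c : V →ₗ[F] (ι → F)) (he : Function.Injective e) (hc : Function.Surjective c) :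
    Function.Injective c := by
  have : FiniteDimensional F V := FiniteDimensional.of_injective e he
  have h1 := LinearMap.finrank_le_finrank_of_injective he
  have h2 : Module.finrank F (ι → F) ≤ Module.finrank F V :=  LinearMap.finrank_le_finrank_of_surjective hc
  exact (LinearMap.injective_iff_surjective_of_finrank_eq_finrank (le_antisymm h1 h2)).mpr hc

lemma inj_of_surj2 {F M ι : Type*} [Field F] [AddCommGroup M] [Module F M] [Fintype ι] (V : Submodule F M)
    (e c : V →ₗ[F] (ι → F)) (he : Function.Injective e) (hc : Function.Surjective c) :
    Function.Injective c := inj_of_surj e c he hc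
lemma inj_of_surj3 {F M ι : Type*} [Field F]  [Fintype ι] (V : Submodule F (MvPolynomial M F))
    (e c : V →ₗ[F] (ι → F)) (he : Function.Injective e) (hc : Function.Surjective c) :
    Function.Injective c := inj_of_surj2 V e c he hc
lemma inj_K {M ι : Type*} [Fintype ι] (V : Submodule K (MvPolynomial M K))
    (e c : V →ₗ[K] (ι → K)) (he : Function.Injective e) (hc : Function.Surjective c) :
    Function.Injective c := inj_of_surj3 V e c he hc
lemma m1 {F M ι : Type*} [Field F]  [Fintype ι] (V : Submodule F (MvPolynomial M F)) [Module.Finite F V] (h : Module.finrank F V = Module.finrank F (ι → F))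
    (c : V →ₗ[F] (ι → F))  (hc : Function.Surjective c) :
    Function.Injective c := (LinearMap.injective_iff_surjective_of_finrank_eq_finrank h).mpr hc
lemma m1_K {M ι : Type*} [Fintype ι] (V : Submodule K (MvPolynomial M K))[Module.Finite K V] (h : Module.finrank K V = Module.finrank K (ι → K))
    (c : V →ₗ[K] (ι → K))  (hc : Function.Surjective c) :
    Function.Injective c := m1 V h c hc

section Unisolvence
variable {n : ℕ}

lemma sn_mem (l ν : Fin n → ℕ) : ν ∈ SnFinset l ↔ ν ∈ Sn l := by
  simp [SnFinset, Sn]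

/-- compositions of size at most `d` correspond to exponents -/
def idxEquiv (d : ℕ) : {e : Fin n →₀ ℕ | (e.sum fun _ k => k) ≤ d} ≃ {ν : Fin n → ℕ // csize ν ≤ d} :=
  Finsupp.equivFunOnFinite.subtypeEquiv (fun e => by
    have := sum_coe_eq_csize e
    change (e.sum fun _ k => k) ≤ d ↔ csize (⇑e) ≤ d
    rw [this])

lemma finite_idx (d : ℕ) : Finite {ν : Fin n → ℕ // csize ν ≤ d} := by
  have h : (Set.univ.pi (fun _ : Fin n => Set.Iic d)).Finite :=
    Set.Finite.pi' (fun _ => Set.finite_Iic d) |>.subset (fun f hf i => by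
      simpa using hf i (Set.mem_univ i))
  apply Set.Finite.to_subtype (h.subset _)
  intro ν hν i _
  exact (Finset.single_le_sum (f := ν) (fun _ _ => Nat.zero_le _) (Finset.mem_univ i)).trans hν

/-- The evaluation map. -/
def evMap (d : ℕ) :
    restrictTotalDegree (Fin n) K d →ₗ[K] ({ν : Fin n → ℕ // csize ν ≤ d} → K) :=
  (LinearMap.pi (fun ν : {ν : Fin n → ℕ // csize ν ≤ d} =>
    (aeval (R := K) (evalPt ν.1)).toLinearMap)).domRestrict _

lemma evMap_apply (d : ℕ) (f : restrictTotalDegree (Fin n) K d)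
    (ν : {ν : Fin n → ℕ // csize ν ≤ d}) : evMap d f ν = eval (evalPt ν.1) f.1 := by
  simp [evMap]

lemma evMap_surj (hn : 1 ≤ n) (d : ℕ) : Function.Surjective (evMap (n := n) d) := by
  have := finite_idx (n := n) d
  have := Fintype.ofFinite {ν : Fin n → ℕ // csize ν ≤ d}
  rw [← LinearMap.range_eq_top]
  have key : ∀ k : ℕ, ∀ μ : {ν : Fin n → ℕ // csize ν ≤ d}, d - csize μ.1 = k →
      Pi.single μ (1 : K) ∈ LinearMap.range (evMap (n := n) d) := by
    intro k
    induction k using Nat.strong_induction_on with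
    | _ k ih =>
      intro μ hμ
      obtain ⟨f, h1, h2, h3, -, -⟩ := good_exists hn μ.1
      have hf : f ∈ restrictTotalDegree (Fin n) K d :=
        (mem_restrictTotalDegree _ _ _).mpr (h1.trans μ.2)
      have hv : evMap d ⟨f, hf⟩ ∈ LinearMap.range (evMap (n := n) d) := ⟨_, rfl⟩
      have e : evMap d ⟨f, hf⟩ = ∑ ν, (eval (evalPt ν.1) f) • (Pi.single ν (1 : K)) := by
        rw [pi_eq_sum_univ' (evMap d ⟨f, hf⟩)]
        apply Finset.sum_congr rfl
        intro ν _
        rw [evMap_apply]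
      rw [← Finset.add_sum_erase _ _ (Finset.mem_univ μ)] at e
      have hr : ∑ ν ∈ Finset.univ.erase μ, (eval (evalPt ν.1) f) • (Pi.single ν (1 : K)) ∈
          LinearMap.range (evMap (n := n) d) := by
        apply Submodule.sum_mem
        intro ν hν
        by_cases hc : csize ν.1 ≤ csize μ.1
        · rw [h2 ν.1 hc (fun h => (Finset.ne_of_mem_erase hν) (Subtype.ext h)), zero_smul]
          exact Submodule.zero_mem _
        · apply Submodule.smul_mem
          exact ih (d - csize ν.1) (by have := ν.2; omega) ν rfl
      have : (eval (evalPt μ.1) f) • (Pi.single μ (1 : K)) ∈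
          LinearMap.range (evMap (n := n) d) := by
        rw [e] at hv
        exact (Submodule.add_mem_iff_left _ hr).mp hv
      exact (Submodule.smul_mem_iff _ h3).mp this
  rw [eq_top_iff]
  intro g _
  rw [pi_eq_sum_univ' g]
  apply Submodule.sum_mem
  intro ν _
  apply Submodule.smul_mem
  exact key _ ν rfl

lemma unisolvent (hn : 1 ≤ n) (d : ℕ) (f : MvPolynomial (Fin n) K) (hd : f.totalDegree ≤ d)
    (h : ∀ ν : Fin n → ℕ, csize ν ≤ d → eval (evalPt ν) f = 0) : f = 0 := by
  have := finite_idx (n := n) d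
  have := Fintype.ofFinite {ν : Fin n → ℕ // csize ν ≤ d}
  have hfr : Module.finrank K (restrictTotalDegree (Fin n) K d) =
      Module.finrank K ({ν : Fin n → ℕ // csize ν ≤ d} → K) := by
    rw [Module.finrank_fintype_fun_eq_card]
    exact Module.finrank_eq_card_basis
      ((basisRestrictSupport K {e : Fin n →₀ ℕ | (e.sum fun _ k => k) ≤ d}).reindex (idxEquiv d))
  have hinj : Function.Injective (evMap (n := n) d) :=
    m1_K (restrictTotalDegree (Fin n) K d) hfr (evMap d) (evMap_surj hn d)
  have hf : f ∈ restrictTotalDegree (Fin n) K d := (mem_restrictTotalDegree _ _ _).mpr hd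
  have : (⟨f, hf⟩ : restrictTotalDegree (Fin n) K d) = 0 := by
    apply hinj
    rw [map_zero]
    funext ν
    rw [evMap_apply]
    exact h ν.1 ν.2
  exact congrArg Subtype.val this

end Unisolvence

/-! ### The polynomials `E*` and `f*` -/

section Final
variable {n : ℕ}

lemma Estar_spec (hn : 1 ≤ n) (l : Fin n → ℕ) : IsEstar l (Estar l) ∧
    ∀ ν : Fin n → ℕ, csize ν = csize l → coeff (expOf ν) (Estar l) ≠ 0 → ble ν l := by
  obtain ⟨g, h1, h2, h3, h4, h5⟩ := good_exists hn l
  have hex : ∃ f, IsEstar l f := by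
    refine ⟨C (coeff (expOf l) g)⁻¹ * g, ?_, ?_, ?_⟩
    · exact (totalDegree_mul _ _).trans (by simpa using h1)
    · rw [coeff_C_mul, inv_mul_cancel₀ h4]
    · intro ν hν hne
      rw [map_mul, h2 ν hν hne, mul_zero]
  have hE : IsEstar l (Estar l) := by
    unfold Estar
    rw [dif_pos hex]
    exact hex.choose_spec
  refine ⟨hE, ?_⟩
  obtain ⟨e1, e2, e3⟩ := hE
  have hz : Estar l - C (eval (evalPt l) (Estar l) / eval (evalPt l) g) * g = 0 := by
    apply unisolvent hn (csize l)
    · refine (totalDegree_sub _ _).trans (max_le e1 ?_)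
      exact (totalDegree_mul _ _).trans (by simpa using h1)
    · intro ν hν
      rw [map_sub, map_mul, eval_C]
      by_cases hne : ν = l
      · rw [hne, div_mul_cancel₀ _ h3, sub_self]
      · rw [e3 ν hν hne, h2 ν hν hne, mul_zero, sub_zero]
  intro ν hν hc
  rw [sub_eq_zero.mp hz, coeff_C_mul] at hc
  exact h5 ν hν (right_ne_zero_of_mul hc)

lemma ble_orbit {l ν : Fin n → ℕ} (hl : IsPartition l) (hν : ν ∈ Sn l) (h : ble ν l) : ν = l := by
  have hsum : ∀ m, ∑ i, (ν i - m) = ∑ i, (l i - m) := by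
    intro m
    obtain ⟨σ, rfl⟩ := hν
    exact Equiv.sum_comp σ.symm (fun i => l i - m)
  have hN : ∀ m r, ∀ κ : Fin n → ℕ, ∑ i, (κ i - m) =
      NN m r κ + ∑ i : Fin n, (if i.val < r ∧ m < κ i then 1 else 0) := by
    intro m r κ
    unfold NN
    rw [← Finset.sum_add_distrib]
    apply Finset.sum_congr rfl
    intro i _
    split_ifs <;> omega
  have hge : ∀ i, l i ≤ ν i := by
    intro i
    by_contra hlt
    push Not at hlt
    have a1 := h.2 (l i - 1) (i.val + 1) i.isLt
    have a2 := hN (l i - 1) (i.val + 1) ν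
    have a3 := hN (l i - 1) (i.val + 1) l
    have a4 := hsum (l i - 1)
    have a5 : ∑ j : Fin n, (if j.val < i.val + 1 ∧ l i - 1 < ν j then 1 else 0) <
        ∑ j : Fin n, (if j.val < i.val + 1 ∧ l i - 1 < l j then 1 else 0) := by
      apply Finset.sum_lt_sum
      · intro j _
        by_cases hj : j.val < i.val + 1
        · have : l i ≤ l j := hl j i (by rw [Fin.le_def]; omega)
          have h2 : l i - 1 < l j := by omega
          simp only [hj, h2, and_self, if_true, true_and]
          split_ifs <;> omega
        · simp [hj]
      · refine ⟨i, Finset.mem_univ i, ?_⟩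
        rw [if_neg (by omega), if_pos (by omega)]
        omega
    omega
  have := (Finset.sum_eq_sum_iff_of_le (s := Finset.univ) (f := l) (g := ν)
    (fun i _ => hge i)).mp h.1.symm
  funext i
  exact (this i (Finset.mem_univ i)).symm

/-- Membership in `V*`. -/
def InV (l : Fin n → ℕ) (f : MvPolynomial (Fin n) K) : Prop :=
  f.totalDegree ≤ csize l ∧
    ∀ ν : Fin n → ℕ, csize ν ≤ csize l → ν ∉ Sn l → eval (evalPt ν) f = 0

/-- Dominance of the top-degree part. -/
def Dom (l : Fin n → ℕ) (f : MvPolynomial (Fin n) K) : Prop :=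
  ∀ ν : Fin n → ℕ, csize ν = csize l → coeff (expOf ν) f ≠ 0 →
    ∀ m, ∑ i, (ν i - m) ≤ ∑ i, (l i - m)

lemma sn_swap {l ν : Fin n → ℕ} (a b : Fin n) (h : ν ∈ Sn l) : ν ∘ Equiv.swap a b ∈ Sn l := by
  obtain ⟨σ, rfl⟩ := h
  exact ⟨Equiv.swap a b * σ, by rw [permAct_mul]; rfl⟩

lemma InV_hecke {l : Fin n → ℕ} (i : {i : ℕ // i + 1 < n}) {f : MvPolynomial (Fin n) K}
    (h : InV l f) : InV l (hecke (ia i) (ib i) f) := by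
  refine ⟨hecke_totalDegree (ia_ne_ib i) f _ h.1, ?_⟩
  intro ν hν hne
  apply hecke_eval_zero (iab i) ν f (h.2 ν hν hne)
  apply h.2 _ (by rw [csize_swap]; exact hν)
  intro h'
  apply hne
  have := sn_swap (ia i) (ib i) h'
  rwa [swap_swap_comp] at this

lemma Dom_hecke {l : Fin n → ℕ} {a b : Fin n} (hab : a ≠ b) {f : MvPolynomial (Fin n) K}
    (h : Dom l f) : Dom l (hecke a b f) := by
  intro τ hτ hc m
  obtain ⟨ν, h1, h2, h3, h4⟩ := hecke_support' hab τ f hc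
  refine le_trans ?_ (h ν (by rw [← csize_eq_of_off hab τ ν h2 h3]; exact hτ) h1 m)
  rw [sum_split hab, sum_split hab (fun i => ν i - m)]
  have : ∑ i ∈ Finset.univ.filter (fun i => i ≠ a ∧ i ≠ b), (τ i - m) =
      ∑ i ∈ Finset.univ.filter (fun i => i ≠ a ∧ i ≠ b), (ν i - m) := by
    apply Finset.sum_congr rfl
    intro i hi
    rw [Finset.mem_filter] at hi
    rw [h2 i hi.2.1 hi.2.2]
  rw [this]
  omega

lemma sn_csize {l τ : Fin n → ℕ} (h : τ ∈ Sn l) : csize τ = csize l := by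
  obtain ⟨σ, rfl⟩ := h
  exact csize_permAct σ l

lemma ln_swap {a b : Fin n} (hab : a ≠ b) (τ : Fin n → ℕ) :
    ln τ a b (τ b) (τ a) = expOf (τ ∘ Equiv.swap a b) := by
  ext k
  rw [ln_apply, expOf_apply, Function.comp_apply]
  by_cases ha : k = a
  · subst ha; simp [hab]
  · by_cases hb : k = b
    · subst hb; simp
    · rw [Equiv.swap_apply_of_ne_of_ne ha hb]; simp [ha, hb]

lemma Dom_coeff {l : Fin n → ℕ} {a b : Fin n} (hab : a ≠ b) {f : MvPolynomial (Fin n) K}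
    (h : Dom l f) (τ : Fin n → ℕ) (hτ : τ ∈ Sn l) :
    coeff (expOf τ) (hecke a b f) =
      if τ a = τ b then tt * coeff (expOf τ) f
      else if τ a < τ b then
        coeff (expOf (τ ∘ Equiv.swap a b)) f + (tt - 1) * coeff (expOf τ) f
      else tt * coeff (expOf (τ ∘ Equiv.swap a b)) f := by
  rw [hecke_coeff_reduced hab τ f, ln_swap hab]
  intro x y hxy hmin
  by_contra hc
  have va : (ln τ a b x y) a = x := by rw [ln_apply]; simp [hab]
  have vb : (ln τ a b x y) b = y := by rw [ln_apply]; simp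
  have vo : ∀ i, i ≠ a → i ≠ b → (ln τ a b x y) i = τ i := by
    intro i h1 h2; rw [ln_apply]; simp [h1, h2]
  rw [← expOf_coe (ln τ a b x y)] at hc
  have hs := csize_eq_of_off hab (⇑(ln τ a b x y)) τ vo (by rw [va, vb, hxy])
  have h1 := h _ (hs.trans (sn_csize hτ)) hc (max (τ a) (τ b))
  have h2 : ∑ i, (l i - max (τ a) (τ b)) = ∑ i, (τ i - max (τ a) (τ b)) := by
    obtain ⟨σ, hσ⟩ := hτ
    have := Equiv.sum_comp σ.symm (fun i => l i - max (τ a) (τ b))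
    rw [← this]
    apply Finset.sum_congr rfl
    intro i _
    rw [← congrFun hσ i]; rfl
  rw [h2, sum_split hab, sum_split hab (fun i => τ i - max (τ a) (τ b)), va, vb] at h1
  have : ∑ i ∈ Finset.univ.filter (fun i => i ≠ a ∧ i ≠ b),
        ((ln τ a b x y) i - max (τ a) (τ b)) =
      ∑ i ∈ Finset.univ.filter (fun i => i ≠ a ∧ i ≠ b), (τ i - max (τ a) (τ b)) := by
    apply Finset.sum_congr rfl
    intro i hi
    rw [Finset.mem_filter] at hi
    rw [vo i hi.2.1 hi.2.2]
  rw [this] at h1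
  omega

/-- The characterizing properties of `f*_μ`. -/
def Fine (l μ : Fin n → ℕ) (f : MvPolynomial (Fin n) K) : Prop :=
  InV l f ∧ Dom l f ∧ ∀ τ ∈ Sn l, coeff (expOf τ) f = if τ = μ then 1 else 0

lemma Fine_Estar (hn : 1 ≤ n) {l : Fin n → ℕ} (hl : IsPartition l) : Fine l l (Estar l) := by
  obtain ⟨⟨h1, h2, h3⟩, h4⟩ := Estar_spec hn l
  have hmem : l ∈ Sn l := ⟨1, rfl⟩
  refine ⟨⟨h1, ?_⟩, ?_, ?_⟩
  · intro ν hν hne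
    exact h3 ν hν (fun h => hne (h ▸ hmem))
  · intro ν hν hc m
    have := (h4 ν hν hc).2 m 0 (Nat.zero_le _)
    simpa [NN] using this
  · intro τ hτ
    split_ifs with h
    · rw [h, h2]
    · by_contra hc
      exact h (ble_orbit hl hτ (h4 τ (sn_csize hτ) hc))

lemma Fine_step {l μ : Fin n → ℕ} (i : {i : ℕ // i + 1 < n}) (hμ : μ (ib i) < μ (ia i))
    {f : MvPolynomial (Fin n) K} (h : Fine l μ f) :
    Fine l (μ ∘ Equiv.swap (ia i) (ib i)) (hecke (ia i) (ib i) f) := by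
  obtain ⟨h1, h2, h3⟩ := h
  refine ⟨InV_hecke i h1, Dom_hecke (ia_ne_ib i) h2, ?_⟩
  intro τ hτ
  rw [Dom_coeff (ia_ne_ib i) h2 τ hτ, h3 τ hτ, h3 _ (sn_swap _ _ hτ)]
  have e : τ ∘ Equiv.swap (ia i) (ib i) = μ ↔ τ = μ ∘ Equiv.swap (ia i) (ib i) := by
    constructor
    · intro h; rw [← h, swap_swap_comp]
    · intro h; rw [h, swap_swap_comp]
  have e2 : τ = μ ∘ Equiv.swap (ia i) (ib i) → τ (ia i) = μ (ib i) ∧ τ (ib i) = μ (ia i) := by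
    intro h; rw [h]; simp
  simp only [e]
  have e3 : τ = μ → τ (ia i) = μ (ia i) ∧ τ (ib i) = μ (ib i) := by
    intro h; rw [h]; simp
  split_ifs with c1 c2 c3 c4 c5 c6 c7 c8 c9
  all_goals first
    | (exfalso; have := e3 (by assumption); omega)
    | (exfalso; have := e2 (by assumption); omega)
    | simp

lemma Fine_word (hn : 1 ≤ n) {l : Fin n → ℕ} (hl : IsPartition l)
    (w : List {i : ℕ // i + 1 < n}) (hw : w.length ≤ inv (permAct (w.map adjSwap).prod l)) :
    Fine l (permAct (w.map adjSwap).prod l) (Tword w (Estar l)) := by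
  induction w with
  | nil => exact Fine_Estar hn hl
  | cons i w ih =>
    obtain ⟨a1, a2⟩ := word_step hl i w hw
    exact Fine_step i a2 (ih a1)

lemma Fine_fstar (hn : 1 ≤ n) {l : Fin n → ℕ} (hl : IsPartition l) (μ : Fin n → ℕ)
    (hμ : μ ∈ Sn l) : Fine l μ (fstar μ) := by
  have hs : sortDesc μ = l := by
    obtain ⟨σ, rfl⟩ := hμ
    exact sortDesc_eq hl σ
  obtain ⟨w, h1, h2, h3⟩ := sigmaMin_word hl μ hμ
  unfold fstar
  rw [hs, h1]
  have := Fine_word hn hl w (by rw [h2]; exact h3)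
  rwa [h2] at this

/-- `V*` as a submodule. -/
def VS (l : Fin n → ℕ) : Submodule K (MvPolynomial (Fin n) K) where
  carrier := {f | InV l f}
  zero_mem' := ⟨by simp, fun _ _ _ => map_zero _⟩
  add_mem' := by
    intro f g hf hg
    refine ⟨(totalDegree_add _ _).trans (max_le hf.1 hg.1), fun ν h1 h2 => ?_⟩
    rw [map_add, hf.2 ν h1 h2, hg.2 ν h1 h2, add_zero]
  smul_mem' := by
    intro c f hf
    refine ⟨(totalDegree_smul_le _ _).trans hf.1, fun ν h1 h2 => ?_⟩
    rw [smul_eval, hf.2 ν h1 h2, mul_zero]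

lemma coeff_inj (hn : 1 ≤ n) {l : Fin n → ℕ} (hl : IsPartition l) (f : MvPolynomial (Fin n) K)
    (hf : InV l f) (h : ∀ τ ∈ Sn l, coeff (expOf τ) f = 0) : f = 0 := by
  let evL : VS l →ₗ[K] ({ν // ν ∈ SnFinset l} → K) :=
    (LinearMap.pi (fun ν : {ν // ν ∈ SnFinset l} =>
      (aeval (R := K) (evalPt ν.1)).toLinearMap)).domRestrict _
  let coL : VS l →ₗ[K] ({ν // ν ∈ SnFinset l} → K) :=
    (LinearMap.pi (fun ν : {ν // ν ∈ SnFinset l} => lcoeff K (expOf ν.1))).domRestrict _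
  have evA : ∀ g ν, evL g ν = eval (evalPt ν.1) g.1 := by
    intro g ν; simp [evL]
  have coA : ∀ g ν, coL g ν = coeff (expOf ν.1) g.1 := by
    intro g ν; simp [coL]
  have evI : Function.Injective evL := by
    rw [injective_iff_map_eq_zero]
    intro g hg
    apply Subtype.ext
    apply unisolvent hn (csize l) g.1 g.2.1
    intro ν hν
    by_cases hm : ν ∈ Sn l
    · have := evA g ⟨ν, (sn_mem l ν).mpr hm⟩
      rw [hg] at this
      exact this.symm
    · exact g.2.2 ν hν hm
  have coS : Function.Surjective coL := by
    rw [← LinearMap.range_eq_top, eq_top_iff]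
    intro g _
    rw [pi_eq_sum_univ' g]
    apply Submodule.sum_mem
    intro μ _
    apply Submodule.smul_mem
    have hF := Fine_fstar hn hl μ.1 ((sn_mem l _).mp μ.2)
    refine ⟨⟨fstar μ.1, hF.1⟩, ?_⟩
    funext τ
    rw [coA, hF.2.2 τ.1 ((sn_mem l _).mp τ.2)]
    simp only [Pi.single_apply, Subtype.ext_iff]
  have coI := inj_K (VS l) evL coL evI coS
  have : (⟨f, hf⟩ : VS l) = 0 := by
    apply coI
    rw [map_zero]
    funext τ
    rw [coA]
    exact h τ.1 ((sn_mem l _).mp τ.2)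
  exact congrArg Subtype.val this

/-- The sum of the `f*_μ`. -/
def FF (l : Fin n → ℕ) : MvPolynomial (Fin n) K := ∑ μ ∈ SnFinset l, fstar μ

lemma FF_spec (hn : 1 ≤ n) {l : Fin n → ℕ} (hl : IsPartition l) :
    InV l (FF l) ∧ Dom l (FF l) ∧ ∀ τ ∈ Sn l, coeff (expOf τ) (FF l) = 1 := by
  have hF : ∀ μ ∈ SnFinset l, Fine l μ (fstar μ) := fun μ hμ =>
    Fine_fstar hn hl μ ((sn_mem l _).mp hμ)
  refine ⟨?_, ?_, ?_⟩
  · exact Submodule.sum_mem (VS l) (fun μ hμ => (hF μ hμ).1)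
  · intro ν hν hc m
    unfold FF at hc
    rw [coeff_sum] at hc
    obtain ⟨μ, hμ, hne⟩ := Finset.exists_ne_zero_of_sum_ne_zero hc
    exact (hF μ hμ).2.1 ν hν hne m
  · intro τ hτ
    unfold FF
    rw [coeff_sum, Finset.sum_congr rfl (fun μ hμ => (hF μ hμ).2.2 τ hτ)]
    simp [(sn_mem l τ).mpr hτ]

lemma FF_hecke (hn : 1 ≤ n) {l : Fin n → ℕ} (hl : IsPartition l) (i : {i : ℕ // i + 1 < n}) :
    hecke (ia i) (ib i) (FF l) = C tt * FF l := by
  obtain ⟨h1, h2, h3⟩ := FF_spec hn hl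
  rw [← sub_eq_zero]
  apply coeff_inj hn hl
  · rw [← smul_eq_C_mul]
    exact Submodule.sub_mem (VS l) (InV_hecke i h1) (Submodule.smul_mem (VS l) tt h1)
  · intro τ hτ
    rw [coeff_sub, coeff_C_mul, Dom_coeff (ia_ne_ib i) h2 τ hτ, h3 τ hτ, h3 _ (sn_swap _ _ hτ)]
    split_ifs <;> ring

lemma FF_symm (hn : 1 ≤ n) {l : Fin n → ℕ} (hl : IsPartition l) : (FF l).IsSymmetric := by
  intro σ
  obtain ⟨w, rfl, -⟩ := exists_reduced σ
  induction w with
  | nil => simp [Equiv.Perm.coe_one]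
  | cons i w ih =>
    rw [List.map_cons, List.prod_cons, Equiv.Perm.coe_mul, ← rename_rename, ih]
    exact swap_eq_of_hecke (ia_ne_ib i) _ (FF_hecke hn hl i)

lemma FF_isPstar (hn : 1 ≤ n) {l : Fin n → ℕ} (hl : IsPartition l) : IsPstar l (FF l) := by
  obtain ⟨h1, h2, h3⟩ := FF_spec hn hl
  refine ⟨FF_symm hn hl, h1.1, h3 l ⟨1, rfl⟩, ?_⟩
  intro ν hν hs hne
  apply h1.2 ν hs
  rintro ⟨σ, hσ⟩
  exact hne (partition_unique hl hν σ hσ).symm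

lemma symm_eval {g : MvPolynomial (Fin n) K} (hg : g.IsSymmetric) (ν : Fin n → ℕ) 
    (w : List {i : ℕ // i + 1 < n}) :
    eval (evalPt (permAct (w.map adjSwap).prod ν)) g = eval (evalPt ν) g := by
  induction w with
  | nil => rfl
  | cons i w ih =>
    rw [List.map_cons, List.prod_cons, permAct_mul, permAct_adjSwap, ← ih]
    generalize permAct (w.map adjSwap).prod ν = κ
    by_cases he : κ (ia i) = κ (ib i)
    · congr 2
      congr 1
      funext k
      rw [Function.comp_apply]
      by_cases ha : k = ia i
      · rw [ha, Equiv.swap_apply_left, he]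
      · by_cases hb : k = ib i
        · rw [hb, Equiv.swap_apply_right, he]
        · rw [Equiv.swap_apply_of_ne_of_ne ha hb]
    · rw [← evalPt_swap (iab i) κ he, ← eval_rename, hg]

lemma Pstar_zero (hn : 1 ≤ n) {l : Fin n → ℕ} (g : MvPolynomial (Fin n) K)
    (h1 : g.IsSymmetric) (h2 : g.totalDegree ≤ csize l)
    (h3 : ∀ ν : Fin n → ℕ, IsPartition ν → csize ν ≤ csize l → ν ≠ l → eval (evalPt ν) g = 0)
    (h4 : eval (evalPt l) g = 0) : g = 0 := by
  apply unisolvent hn _ _ h2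
  intro ν hν
  obtain ⟨κ, w, hκ, -, rfl⟩ := exists_word _ ν rfl
  rw [symm_eval h1]
  rw [csize_permAct] at hν
  by_cases hne : κ = l
  · rw [hne, h4]
  · exact h3 κ hκ hν hne

lemma Pstar_unique (hn : 1 ≤ n) {l : Fin n → ℕ} (g f : MvPolynomial (Fin n) K)
    (hg : IsPstar l g) (hf : IsPstar l f) : g = f := by
  obtain ⟨f1, f2, f3, f4⟩ := hf
  obtain ⟨g1, g2, g3, g4⟩ := hg
  have hne : eval (evalPt l) f ≠ 0 := by
    intro h
    rw [Pstar_zero hn f f1 f2 f4 h] at f3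
    simp at f3
  have hz : g - C (eval (evalPt l) g / eval (evalPt l) f) * f = 0 := by
    apply Pstar_zero hn (l := l)
    · intro σ
      rw [map_sub, map_mul, rename_C, g1, f1]
    · refine (totalDegree_sub _ _).trans (max_le g2 ?_)
      exact (totalDegree_mul _ _).trans (by simpa using f2)
    · intro ν a b c
      rw [map_sub, map_mul, g4 ν a b c, f4 ν a b c, mul_zero, sub_zero]
    · rw [map_sub, map_mul, eval_C, div_mul_cancel₀ _ hne, sub_self]
  rw [sub_eq_zero] at hz
  have hc := congrArg (coeff (expOf l)) hz
  rw [coeff_C_mul, g3, f3, mul_one] at hc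
  rw [hz, ← hc, C_1, one_mul]

end Final

/-- `P*_λ = Σ_{μ ∈ S_n(λ)} f*_μ`. -/
theorem statement7 (n : ℕ) (hn : 1 ≤ n) (l : Fin n → ℕ) (hl : IsPartition l) :
    Pstar l = ∑ μ ∈ SnFinset l, fstar μ := by
  have hP : IsPstar l (Pstar l) := by
    have hex : ∃ f, IsPstar l f := ⟨FF l, FF_isPstar hn hl⟩
    unfold Pstar
    rw [dif_pos hex]
    exact hex.choose_spec
  exact Pstar_unique hn (Pstar l) (FF l) hP (FF_isPstar hn hl)
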